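/- arXiv:2007.05574 — 3 statements merged into one kernel-verified Lean document; each statement's English description precedes it below -/
import Mathlib

section
/- Let R be a commutative integral domain that is not a field. The following are equivalent: (a) R is one-dimensional and stable; (b) R is finitely stable and Mori; (c) R is stable and Mori. -/
noncomputable section

open scoped nonZeroDivisors Pointwise

set_option synthInstance.maxHeartbeats 1000000
set_option maxHeartbeats 1000000

/-- For a nonzero ideal `I` of a domain `R`, viewed as a fractional ideal `J` of the quotient
field, the endomorphism ring `(I : I)` is `J / J` and `{z ∈ K | zI ⊆ (I : I)}` is `J / J / J`.
The ideal `I` is *stable* if it is invertible as an ideal of `(I : I)`, i.e.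
`I * ((I:I) : I) = (I:I)`. -/
def Ideal.IsStableIdeal {R : Type*} [CommRing R] [IsDomain R] (I : Ideal R) : Prop :=
  (I : FractionalIdeal R⁰ (FractionRing R)) *
      ((I : FractionalIdeal R⁰ (FractionRing R)) / (I : FractionalIdeal R⁰ (FractionRing R)) /
        (I : FractionalIdeal R⁰ (FractionRing R))) =
    (I : FractionalIdeal R⁰ (FractionRing R)) / (I : FractionalIdeal R⁰ (FractionRing R))

/-- A domain is *stable* if every nonzero ideal is stable. -/
def StableRing (R : Type*) [CommRing R] [IsDomain R] : Prop :=
  ∀ I : Ideal R, I ≠ ⊥ → I.IsStableIdeal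

/-- A domain is *finitely stable* if every nonzero finitely generated ideal is stable. -/
def FinitelyStableRing (R : Type*) [CommRing R] [IsDomain R] : Prop :=
  ∀ I : Ideal R, I ≠ ⊥ → I.FG → I.IsStableIdeal

/-- An ideal `I` is *divisorial* if `I_v = (I⁻¹)⁻¹ = I`; in terms of fractional ideals,
`1 / (1 / I) = I`. -/
def Ideal.IsDivisorial {R : Type*} [CommRing R] [IsDomain R] (I : Ideal R) : Prop :=
  1 / (1 / (I : FractionalIdeal R⁰ (FractionRing R))) = (I : FractionalIdeal R⁰ (FractionRing R))

/-- A domain is a *Mori domain* if it satisfies the ascending chain condition on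
divisorial ideals. -/
def MoriRing (R : Type*) [CommRing R] [IsDomain R] : Prop :=
  ∀ f : ℕ →o Ideal R, (∀ n, (f n).IsDivisorial) → ∃ n, ∀ m, n ≤ m → f m = f n


section SubmoduleTools

set_option linter.unusedSectionVars false

variable {R : Type*} [CommRing R] [IsDomain R] {K : Type*} [Field K] [Algebra R K]

/-- Stability for submodules of the quotient field. -/
def StabSub (X : Submodule R K) : Prop := (1 : K) ∈ X * (X / X / X)

/-- A submodule which can be scaled into the ring. -/
def FrSub (X : Submodule R K) : Prop := ∃ d : K, d ≠ 0 ∧ ∀ x ∈ X, d * x ∈ (1 : Submodule R K)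

/-- The integral closure as a submodule. -/
def intCl (R : Type*) [CommRing R] (K : Type*) [Field K] [Algebra R K] : Submodule R K :=
  Subalgebra.toSubmodule (integralClosure R K)

theorem mem_intCl {z : K} : z ∈ intCl R K ↔ IsIntegral R z := Iff.rfl

theorem one_mem_UU (X : Submodule R K) : (1 : K) ∈ X / X := by simp

theorem one_le_UU (X : Submodule R K) : 1 ≤ X / X := Submodule.one_le.2 (one_mem_UU X)

theorem UU_mul_self (X : Submodule R K) : X / X * X ≤ X :=
  Submodule.le_div_iff_mul_le.1 le_rfl

theorem UU_mul_UU (X : Submodule R K) : X / X * (X / X) ≤ X / X := by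
  rw [Submodule.le_div_iff_mul_le, mul_assoc]
  calc X / X * (X / X * X) ≤ X / X * X := by gcongr; exact UU_mul_self X
    _ ≤ X := UU_mul_self X

theorem div_mul_le (A X : Submodule R K) : A / X * X ≤ A :=
  Submodule.le_div_iff_mul_le.1 le_rfl

theorem UU_mul_dual (X : Submodule R K) : X / X * (X / X / X) ≤ X / X / X := by
  rw [Submodule.le_div_iff_mul_le, mul_assoc]
  calc X / X * (X / X / X * X) ≤ X / X * (X / X) := by gcongr; exact div_mul_le _ _
    _ ≤ X / X := UU_mul_UU X

theorem one_le_intCl : 1 ≤ intCl R K := Submodule.one_le.2 (one_mem (integralClosure R K))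

theorem le_of_one_mem_mul {A X Y : Submodule R K} (h : (1 : K) ∈ A) (h2 : A * X ≤ Y) : X ≤ Y := by
  intro x hx
  have := h2 (Submodule.mul_mem_mul h hx)
  simpa using this

/-- lying over -/
theorem lying_over {U J : Submodule R K} (h1 : 1 ≤ U) (hU : U * U ≤ U) 
    (hJU : J ≤ U) (hUJ : U * J ≤ J) (h : (1 : K) ∈ J * intCl R K) : (1 : K) ∈ J := by
  let S : Subalgebra R K := U.toSubalgebra (Submodule.one_le.1 h1)
    (fun x y hx hy => hU (Submodule.mul_mem_mul hx hy))
  let j : Ideal S :=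
    { carrier := {u | (u : K) ∈ J}
      zero_mem' := J.zero_mem
      add_mem' := fun ha hb => J.add_mem ha hb
      smul_mem' := fun c x hx => hUJ (Submodule.mul_mem_mul c.2 hx) }
  let C := integralClosure S K
  have key : ∀ x ∈ J * intCl R K, ∃ c ∈ j.map (algebraMap S C), (c : K) = x := by
    intro x hx
    induction hx using Submodule.mul_induction_on' with
    | mem_mul_mem m hm n hn =>
      have hn' : IsIntegral R n := hn
      refine ⟨algebraMap S C ⟨m, hJU hm⟩ * ⟨n, hn'.tower_top⟩, ?_, rfl⟩
      exact Ideal.mul_mem_right _ _ (Ideal.mem_map_of_mem _ hm)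
    | add x _ y _ hx hy =>
      obtain ⟨c, hc, rfl⟩ := hx
      obtain ⟨d, hd, rfl⟩ := hy
      exact ⟨c + d, add_mem hc hd, rfl⟩
  obtain ⟨c, hc, hc1⟩ := key 1 h
  have hc1' : c = 1 := Subtype.ext hc1
  have htop : j.map (algebraMap S C) = ⊤ := (Ideal.eq_top_iff_one _).2 (hc1' ▸ hc)
  have hinj : Function.Injective (algebraMap S C) := by
    intro a b hab
    exact Subtype.ext (congrArg (fun c : C => (c : K)) hab)
  have hAlgInt : (algebraMap S C).IsIntegral := fun x => Algebra.IsIntegral.isIntegral x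
  rw [Ideal.map_eq_top_iff _ hinj hAlgInt] at htop
  exact (Ideal.eq_top_iff_one _).1 htop

theorem lemmaL {Y Z : Submodule R K} (hYZ : Y ≤ Z) (hZ : StabSub Z) (hZY : Z ≤ Y * intCl R K) : Z ≤ Y * (Z / Z) := by
  have h1 : (1 : K) ∈ Y * (Z / Z) * (Z / Z / Z) := by
    apply lying_over (one_le_UU Z) (UU_mul_UU Z)
    · calc Y * (Z / Z) * (Z / Z / Z) ≤ Z * (Z / Z) * (Z / Z / Z) := by gcongr
        _ = (Z / Z) * ((Z / Z / Z) * Z) := by ring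
        _ ≤ (Z / Z) * (Z / Z) := by gcongr; exact div_mul_le _ _
        _ ≤ _ := UU_mul_UU Z
    · calc Z / Z * (Y * (Z / Z) * (Z / Z / Z)) = Y * (Z / Z * (Z / Z)) * (Z / Z / Z) := by ring
        _ ≤ Y * (Z / Z) * (Z / Z / Z) := by gcongr; exact UU_mul_UU Z
    · have : Z * (Z / Z / Z) ≤ Y * (Z / Z) * (Z / Z / Z) * intCl R K := by
        calc Z * (Z / Z / Z) ≤ (Y * intCl R K) * (Z / Z / Z) := by gcongr
          _ = Y * 1 * (Z / Z / Z) * intCl R K := by ring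
          _ ≤ _ := by gcongr; exact one_le_UU Z
      exact this hZ
  apply le_of_one_mem_mul h1
  calc Y * (Z / Z) * (Z / Z / Z) * Z = Y * (Z / Z) * ((Z / Z / Z) * Z) := by ring
    _ ≤ Y * (Z / Z) * (Z / Z) := by gcongr; exact div_mul_le _ _
    _ = Y * (Z / Z * (Z / Z)) := by ring
    _ ≤ _ := by gcongr; exact UU_mul_UU Z

theorem lemmaL' {Y Z : Submodule R K} (hYZ : Y ≤ Z) (hZ : StabSub Z) (hZY : Z ≤ Y * intCl R K) : Y / Y ≤ Z / Z := by
  rw [Submodule.le_div_iff_mul_le]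
  calc Y / Y * Z ≤ Y / Y * (Y * (Z / Z)) := by gcongr; exact lemmaL hYZ hZ hZY
    _ = (Y / Y * Y) * (Z / Z) := by ring
    _ ≤ Z * (Z / Z) := by gcongr; exact (UU_mul_self Y).trans hYZ
    _ = Z / Z * Z := by ring
    _ ≤ Z := UU_mul_self Z

theorem UU_le_intCl_of_fg {X : Submodule R K} (hX : X ≠ ⊥) (hfg : X.FG) : X / X ≤ intCl R K := by
  intro z hz
  obtain ⟨x, hx, hx0⟩ := X.ne_bot_iff.1 hX
  rw [mem_intCl]
  exact isIntegral_of_smul_mem_submodule X hX hfg z (fun n hn => hz n hn)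

/-- Krull intersection -/
theorem krull_int {B : Type*} [CommRing B] [IsDomain B] [Ring.DimensionLEOne B] {a : Ideal B} (ha : a.FG)
    {d : B} (hd : d ≠ 0) (h : ∀ n, d ∈ a ^ n) : a = ⊤ := by
  by_contra hne
  obtain ⟨M, hM, haM⟩ := Ideal.exists_le_maximal a hne
  let A := Localization.AtPrime M
  have hMA : M.primeCompl ≤ B⁰ := M.primeCompl_le_nonZeroDivisors
  haveI : IsDomain A := IsLocalization.isDomain_localization hMA
  haveI : Ring.DimensionLEOne A := Ring.DimensionLEOne.localization A hMA
  have hinj : Function.Injective (algebraMap B A) := IsLocalization.injective A hMA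
  have hd' : algebraMap B A d ≠ 0 := by simpa using hinj.ne hd
  have hmax : a.map (algebraMap B A) ≤ IsLocalRing.maximalIdeal A := by
    rw [← Localization.AtPrime.map_eq_maximalIdeal]
    exact Ideal.map_mono haM
  have hrad : a.map (algebraMap B A) ≤ (Ideal.span {algebraMap B A d}).radical := by
    rw [Ideal.radical_eq_sInf]
    refine le_sInf ?_
    rintro P ⟨hP, hPp⟩
    have : P ≠ ⊥ := by
      rintro rfl
      exact hd' (by simpa using hP)
    have hPm := hPp.isMaximal this
    rw [IsLocalRing.eq_maximalIdeal hPm]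
    exact hmax
  obtain ⟨k, hk⟩ := Ideal.exists_pow_le_of_le_radical_of_fg hrad (ha.map _)
  have h1 : algebraMap B A d ∈ (a.map (algebraMap B A)) ^ (k + 1) := by
    rw [← Ideal.map_pow]
    exact Ideal.mem_map_of_mem _ (h _)
  rw [pow_succ] at h1
  have h2 := Ideal.mul_mono hk hmax h1
  rw [Ideal.mem_span_singleton_mul] at h2
  obtain ⟨z, hz, hz'⟩ := h2
  have : z = 1 := mul_left_cancel₀ hd' (by rw [hz', mul_one])
  subst this
  exact (Ideal.ne_top_iff_one _).1 (IsLocalRing.maximalIdeal.isMaximal A).ne_top hz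

theorem mul_mem_one {x y : K} (hx : x ∈ (1 : Submodule R K)) (hy : y ∈ (1 : Submodule R K)) :
    x * y ∈ (1 : Submodule R K) := by
  have := Submodule.mul_mem_mul hx hy
  rwa [one_mul] at this

theorem intLemma [Ring.DimensionLEOne R]
    (hfs : ∀ X : Submodule R K, X ≠ ⊥ → X.FG → StabSub X)
    {E : Submodule R K} (hE : E * E ≤ E) (h1E : 1 ≤ E) (hfr : FrSub E) : E ≤ intCl R K := by
  intro z hz
  obtain ⟨d, hd, hdE⟩ := hfr
  set J : Submodule R K := 1 ⊔ Submodule.span R {z} with hJ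
  have h1J : (1 : K) ∈ J := (le_sup_left : (1 : Submodule R K) ≤ J) (Submodule.one_le.1 le_rfl)
  have hzJ : z ∈ J := (le_sup_right : _ ≤ J) (Submodule.mem_span_singleton_self z)
  have hJ0 : J ≠ ⊥ := J.ne_bot_iff.2 ⟨1, h1J, one_ne_zero⟩
  have hJfg : J.FG := by
    rw [hJ, Submodule.one_eq_span]
    exact (Submodule.fg_span_singleton _).sup (Submodule.fg_span_singleton _)
  have hJE : J ≤ E := sup_le h1E ((Submodule.span_singleton_le_iff_mem _ _).2 hz)
  have hst : (1 : K) ∈ J * (J / J / J) := hfs J hJ0 hJfg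
  have hUB : J / J ≤ intCl R K := UU_le_intCl_of_fg hJ0 hJfg
  have hJ'U : J / J / J ≤ J / J := fun x hx => by simpa using hx 1 h1J
  have hJ'B := hJ'U.trans hUB
  set J' := J / J / J with hJ'
  have hJnE : ∀ n, J ^ n ≤ E := by
    intro n
    induction n with
    | zero => simpa using h1E
    | succ n ih =>
      rw [pow_succ]
      exact (mul_le_mul' ih hJE).trans hE
  have hdn : ∀ n, d ∈ J' ^ n := by
    intro n
    have h1 : (1 : K) ∈ J ^ n * J' ^ n := by
      rw [← mul_pow]
      have := Submodule.pow_mem_pow _ hst n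
      simpa using this
    have h2 : Submodule.span R {d} * J ^ n ≤ 1 := by
      rw [Submodule.span_singleton_mul]
      rintro _ ⟨x, hx, rfl⟩
      exact hdE x (hJnE n hx)
    have h3 : Submodule.span R {d} ≤ J' ^ n := by
      apply le_of_one_mem_mul h1
      calc J ^ n * J' ^ n * Submodule.span R {d} = (Submodule.span R {d} * J ^ n) * J' ^ n := by ring
        _ ≤ 1 * J' ^ n := by gcongr
        _ = _ := one_mul _
    exact h3 (Submodule.mem_span_singleton_self d)
  obtain ⟨a, ha, b, hb, hab⟩ : ∃ a ∈ J', ∃ b ∈ J', 1 = a + z * b := by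
    rw [hJ, Submodule.sup_mul, one_mul, Submodule.mem_sup] at hst
    obtain ⟨a, ha, y, hy, hay⟩ := hst
    rw [Submodule.mem_span_singleton_mul] at hy
    obtain ⟨b, hb, rfl⟩ := hy
    exact ⟨a, ha, b, hb, hay.symm⟩
  let B := integralClosure R K
  let a' : B := ⟨a, hJ'B ha⟩
  let b' : B := ⟨b, hJ'B hb⟩
  let I : Ideal B := Ideal.span {a', b'}
  have haI : a' ∈ I := Ideal.subset_span (by simp)
  have hbI : b' ∈ I := Ideal.subset_span (by simp)
  have hJI : ∀ x ∈ J', ∃ c ∈ I, (c : K) = x := by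
    intro x hx
    have hxz : x * z ∈ J / J := hx z hzJ
    refine ⟨⟨x, hJ'B hx⟩ * a' + ⟨x * z, hUB hxz⟩ * b',
      add_mem (I.mul_mem_left _ haI) (I.mul_mem_left _ hbI), ?_⟩
    change x * a + x * z * b = x
    linear_combination (-x) * hab
  have hJIn : ∀ n, ∀ x ∈ J' ^ n, ∃ c ∈ I ^ n, (c : K) = x := by
    intro n
    induction n with
    | zero =>
      intro x hx
      rw [pow_zero] at hx
      refine ⟨⟨x, one_le_intCl hx⟩, by simp, rfl⟩
    | succ n ih =>
      intro x hx
      rw [pow_succ] at hx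
      induction hx using Submodule.mul_induction_on' with
      | mem_mul_mem m hm n hn =>
        obtain ⟨c, hc, rfl⟩ := ih m hm
        obtain ⟨e, he, rfl⟩ := hJI n hn
        exact ⟨c * e, by rw [pow_succ]; exact Ideal.mul_mem_mul hc he, rfl⟩
      | add x _ y _ hx hy =>
        obtain ⟨c, hc, rfl⟩ := hx
        obtain ⟨e, he, rfl⟩ := hy
        exact ⟨c + e, add_mem hc he, rfl⟩
  have hdB : d ∈ intCl R K := hJ'B (by simpa using hdn 1)
  have htop : I = ⊤ := by
    apply krull_int (d := (⟨d, hdB⟩ : B)) (Submodule.fg_span (by simp))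
    · intro h
      exact hd (congrArg Subtype.val h)
    · intro n
      obtain ⟨c, hc, hc'⟩ := hJIn n d (hdn n)
      have : c = ⟨d, hdB⟩ := Subtype.ext hc'
      exact this ▸ hc
  have h1I : (1 : B) ∈ I := htop ▸ Submodule.mem_top
  rw [Ideal.mem_span_pair] at h1I
  obtain ⟨u, v, huv⟩ := h1I
  have huv' : (u : K) * a + v * b = 1 := congrArg Subtype.val huv
  have h1J' : (1 : K) ∈ J' := by
    apply lying_over (one_le_UU J) (UU_mul_UU J) hJ'U (UU_mul_dual J)
    rw [← huv', mul_comm (u : K), mul_comm (v : K)]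
    exact add_mem (Submodule.mul_mem_mul ha u.2) (Submodule.mul_mem_mul hb v.2)
  have := h1J' z hzJ
  rw [one_mul] at this
  exact hUB this

end SubmoduleTools

section Bridge

variable {R : Type*} [CommRing R] [IsDomain R]

/-- The image of an ideal in the quotient field. -/
abbrev cS (I : Ideal R) : Submodule R (FractionRing R) :=
  IsLocalization.coeSubmodule (FractionRing R) I

theorem cS_le_one (I : Ideal R) : cS I ≤ 1 := by
  rintro _ ⟨y, _, rfl⟩
  exact Submodule.mem_one.2 ⟨y, rfl⟩

theorem cS_ne_bot {I : Ideal R} (h : I ≠ ⊥) : cS I ≠ ⊥ := by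
  obtain ⟨x, hx, hx0⟩ := Submodule.ne_bot_iff I |>.1 h
  refine (Submodule.ne_bot_iff _).2 ⟨algebraMap R _ x, ⟨x, hx, rfl⟩, ?_⟩
  simpa using hx0

theorem cS_mono {I J : Ideal R} (h : I ≤ J) : cS I ≤ cS J :=
  IsFractionRing.coeSubmodule_le_coeSubmodule.2 h

theorem of_cS_le {I J : Ideal R} (h : cS I ≤ cS J) : I ≤ J :=
  IsFractionRing.coeSubmodule_le_coeSubmodule.1 h

theorem exists_cS {X : Submodule R (FractionRing R)} (h : X ≤ 1) : ∃ I : Ideal R, cS I = X := by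
  refine ⟨X.comap (Algebra.linearMap R (FractionRing R)), ?_⟩
  ext x
  constructor
  · rintro ⟨y, hy, rfl⟩
    exact hy
  · intro hx
    obtain ⟨y, rfl⟩ := Submodule.mem_one.1 (h hx)
    exact ⟨y, hx, rfl⟩

theorem isStable_iff {I : Ideal R} (h : I ≠ ⊥) : I.IsStableIdeal ↔ StabSub (cS I) := by
  have h0 : (I : FractionalIdeal R⁰ (FractionRing R)) ≠ 0 := FractionalIdeal.coeIdeal_ne_zero.2 h
  rw [Ideal.IsStableIdeal, ← FractionalIdeal.coeToSubmodule_inj, FractionalIdeal.coe_mul,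
    FractionalIdeal.coe_div h0, FractionalIdeal.coe_div h0, FractionalIdeal.coe_coeIdeal]
  change cS I * (cS I / cS I / cS I) = cS I / cS I ↔ _
  constructor
  · intro h
    rw [StabSub, h]
    exact one_mem_UU _
  · intro h
    apply le_antisymm
    · rw [mul_comm]
      exact div_mul_le _ _
    · apply le_of_one_mem_mul h
      rw [mul_assoc, mul_comm (cS I / cS I / cS I)]
      gcongr
      exact UU_mul_dual _

theorem one_div_ne_bot {X : Submodule R (FractionRing R)} (h : FrSub X) : 1 / X ≠ ⊥ := by
  obtain ⟨d, hd, h⟩ := h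
  exact (Submodule.ne_bot_iff _).2 ⟨d, h, hd⟩

theorem isDivisorial_iff {I : Ideal R} (h : I ≠ ⊥) :
    I.IsDivisorial ↔ 1 / (1 / cS I) = cS I := by
  have h0 : (I : FractionalIdeal R⁰ (FractionRing R)) ≠ 0 := FractionalIdeal.coeIdeal_ne_zero.2 h
  have h1 : (1 / I : FractionalIdeal R⁰ (FractionRing R)) ≠ 0 := by
    rw [← FractionalIdeal.coeToSubmodule_ne_bot, FractionalIdeal.coe_div h0,
      FractionalIdeal.coe_one]
    apply one_div_ne_bot
    exact ⟨1, one_ne_zero, fun x hx => by rw [one_mul]; exact cS_le_one I hx⟩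
  rw [Ideal.IsDivisorial, ← FractionalIdeal.coeToSubmodule_inj, FractionalIdeal.coe_div h1,
    FractionalIdeal.coe_div h0, FractionalIdeal.coe_coeIdeal, FractionalIdeal.coe_one]

theorem stabSub_scale {K : Type*} [Field K] [Algebra R K] {Y : Submodule R K} (h : StabSub Y) {c : K} (hc : c ≠ 0) :
    StabSub (Submodule.span R {c} * Y) := by
  set s := Submodule.span R {c}
  set t := Submodule.span R {c⁻¹}
  have hst : s * t = 1 := by
    rw [Submodule.span_mul_span, Set.singleton_mul_singleton, mul_inv_cancel₀ hc,
      Submodule.one_eq_span]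
  have h1 : Y / Y ≤ s * Y / (s * Y) := by
    rw [Submodule.le_div_iff_mul_le]
    calc Y / Y * (s * Y) = s * (Y / Y * Y) := by ring
      _ ≤ s * Y := by gcongr; exact UU_mul_self Y
  have h2 : t * (Y / Y / Y) ≤ s * Y / (s * Y) / (s * Y) := by
    rw [Submodule.le_div_iff_mul_le]
    calc t * (Y / Y / Y) * (s * Y) = (s * t) * ((Y / Y / Y) * Y) := by ring
      _ = (Y / Y / Y) * Y := by rw [hst, one_mul]
      _ ≤ Y / Y := div_mul_le _ _
      _ ≤ _ := h1
  have h3 : Y * (Y / Y / Y) ≤ s * Y * (s * Y / (s * Y) / (s * Y)) := by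
    calc Y * (Y / Y / Y) = (s * t) * (Y * (Y / Y / Y)) := by rw [hst, one_mul]
      _ = s * Y * (t * (Y / Y / Y)) := by ring
      _ ≤ _ := by gcongr
  exact h3 h

theorem exists_scale {X : Submodule R (FractionRing R)} (hX : X ≠ ⊥) (h : FrSub X) :
    ∃ I : Ideal R, I ≠ ⊥ ∧ (X.FG → I.FG) ∧ (I.IsStableIdeal → StabSub X) := by
  obtain ⟨d, hd, h⟩ := h
  have hle : Submodule.span R {d} * X ≤ 1 := by
    rw [Submodule.span_singleton_mul]
    rintro _ ⟨x, hx, rfl⟩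
    exact h x hx
  obtain ⟨I, hI⟩ := exists_cS hle
  have hX' : X = Submodule.span R {d⁻¹} * cS I := by
    rw [hI, ← mul_assoc, Submodule.span_mul_span, Set.singleton_mul_singleton, inv_mul_cancel₀ hd,
      ← Submodule.one_eq_span, one_mul]
  have hI0 : I ≠ ⊥ := by
    rintro rfl
    apply hX
    rw [hX']
    simp [cS]
  refine ⟨I, hI0, ?_, ?_⟩
  · intro hfg
    have : (cS I).FG := by
      rw [hI]
      exact (Submodule.fg_span_singleton _).mul hfg
    exact (IsLocalization.coeSubmodule_fg _ (IsFractionRing.injective R (FractionRing R)) I).1 this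
  · intro hs
    rw [hX']
    exact stabSub_scale ((isStable_iff hI0).1 hs) (inv_ne_zero hd)

theorem frSub_of_fg {X : Submodule R (FractionRing R)} (h : X.FG) : FrSub X := by
  obtain ⟨a, ha, h⟩ := FractionalIdeal.isFractional_of_fg (S := R⁰) h
  refine ⟨algebraMap R _ a, by simpa using nonZeroDivisors.ne_zero ha, ?_⟩
  intro x hx
  obtain ⟨y, hy⟩ := h x hx
  rw [Algebra.smul_def] at hy
  exact Submodule.mem_one.2 ⟨y, hy⟩

theorem stableRing_sub (h : StableRing R) (X : Submodule R (FractionRing R)) (hX : X ≠ ⊥)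
    (hf : FrSub X) : StabSub X := by
  obtain ⟨I, hI, _, h2⟩ := exists_scale hX hf
  exact h2 (h I hI)

theorem finStableRing_sub (h : FinitelyStableRing R) (X : Submodule R (FractionRing R)) (hX : X ≠ ⊥)
    (hf : X.FG) : StabSub X := by
  obtain ⟨I, hI, h1, h2⟩ := exists_scale hX (frSub_of_fg hf)
  exact h2 (h I hI (h1 hf))

theorem frSub_mono {X Y : Submodule R (FractionRing R)} (h : X ≤ Y) (hY : FrSub Y) : FrSub X := by
  obtain ⟨d, hd, h'⟩ := hY
  exact ⟨d, hd, fun x hx => h' x (h hx)⟩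

theorem frSub_div {X Y : Submodule R (FractionRing R)} (hY : Y ≠ ⊥) (hX : FrSub X) :
    FrSub (X / Y) := by
  obtain ⟨d, hd, h'⟩ := hX
  obtain ⟨y, hy, hy0⟩ := (Submodule.ne_bot_iff _).1 hY
  refine ⟨d * y, mul_ne_zero hd hy0, fun x hx => ?_⟩
  have := h' _ (hx y hy)
  rwa [mul_comm x, ← mul_assoc] at this

theorem frSub_one : FrSub (1 : Submodule R (FractionRing R)) :=
  ⟨1, one_ne_zero, fun x hx => by rwa [one_mul]⟩

theorem ne_bot_of_one_mem_left {X Y : Submodule R (FractionRing R)} (h : (1 : FractionRing R) ∈ X * Y) :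
    X ≠ ⊥ := by
  rintro rfl
  rw [Submodule.bot_mul] at h
  exact one_ne_zero (h : (1 : FractionRing R) = 0)

theorem le_one_div_one_div (X : Submodule R (FractionRing R)) : X ≤ 1 / (1 / X) := by
  rw [Submodule.le_div_iff_mul_le]
  exact Submodule.mul_one_div_le_one

theorem one_div_anti {X Y : Submodule R (FractionRing R)} (h : X ≤ Y) : 1 / Y ≤ 1 / X := by
  rw [Submodule.le_div_iff_mul_le]
  calc 1 / Y * X ≤ 1 / Y * Y := by gcongr
    _ ≤ 1 := div_mul_le _ _

theorem one_div_triple (X : Submodule R (FractionRing R)) : 1 / (1 / (1 / X)) = 1 / X :=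
  le_antisymm (one_div_anti (le_one_div_one_div X)) (le_one_div_one_div _)

theorem UU_one_div {I : Submodule R (FractionRing R)} (h : 1 / (1 / I) = I) :
    1 / I / (1 / I) = I / I := by
  apply le_antisymm
  · rw [Submodule.le_div_iff_mul_le]
    conv_rhs => rw [← h]
    rw [Submodule.le_div_iff_mul_le]
    calc 1 / I / (1 / I) * I * (1 / I) = (1 / I / (1 / I) * (1 / I)) * I := by ring
      _ ≤ 1 / I * I := by gcongr; exact UU_mul_self _
      _ ≤ 1 := div_mul_le _ _
  · rw [Submodule.le_div_iff_mul_le, Submodule.le_div_iff_mul_le]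
    calc I / I * (1 / I) * I = 1 / I * (I / I * I) := by ring
      _ ≤ 1 / I * I := by gcongr; exact UU_mul_self _
      _ ≤ 1 := div_mul_le _ _

theorem mem_mul_of_chain {D : ℕ → Submodule R (FractionRing R)} (hD : Monotone D)
    {Y : Submodule R (FractionRing R)} {x : FractionRing R} (h : x ∈ (⨆ n, D n) * Y) :
    ∃ n, x ∈ D n * Y := by
  rw [Submodule.iSup_mul] at h
  have hm : Monotone fun n => D n * Y := fun a b hab => mul_le_mul_left (hD hab) _
  rwa [Submodule.mem_iSup_of_directed _ hm.directed_le] at h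

theorem mori_of_stable [Ring.DimensionLEOne R] (hs : StableRing R) : MoriRing R := by
  intro f hf
  have hfs : ∀ X : Submodule R (FractionRing R), X ≠ ⊥ → X.FG → StabSub X :=
    fun X h0 hX => stableRing_sub hs X h0 (frSub_of_fg hX)
  by_cases hbot : ∀ n, f n = ⊥
  · exact ⟨0, fun m _ => by rw [hbot, hbot]⟩
  push Not at hbot
  obtain ⟨k, hk⟩ := hbot
  set I : ℕ → Submodule R (FractionRing R) := fun n => cS (f n) with hI
  have hImono : Monotone I := fun a b hab => cS_mono (f.mono hab)
  set T : Submodule R (FractionRing R) := ⨆ n, I n with hT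
  have hIT : ∀ n, I n ≤ T := fun n => le_iSup I n
  have hT1 : T ≤ 1 := iSup_le fun n => cS_le_one _
  have hT0 : T ≠ ⊥ := fun h => cS_ne_bot hk (le_bot_iff.1 (h ▸ hIT k))
  have hTst : StabSub T := stableRing_sub hs T hT0 (frSub_mono hT1 frSub_one)
  obtain ⟨n0, hn0⟩ := mem_mul_of_chain hImono hTst
  set E := T / T with hE
  have hTI : ∀ n, n0 ≤ n → T ≤ I n * E := by
    intro n hn
    apply le_of_one_mem_mul hn0
    calc I n0 * (E / T) * T = I n0 * (E / T * T) := by ring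
      _ ≤ I n * E := by
        gcongr
        · exact hImono hn
        · exact div_mul_le _ _
  have hEfr : FrSub E := frSub_div hT0 (frSub_mono hT1 frSub_one)
  have hEB : E ≤ intCl R (FractionRing R) :=
    intLemma hfs (UU_mul_UU T) (one_le_UU T) hEfr
  have hI0 : ∀ n, n0 ≤ n → I n ≠ ⊥ := by
    intro n hn h
    exact ne_bot_of_one_mem_left hn0 (le_bot_iff.1 (h ▸ hImono hn))
  have hIst : ∀ n, n0 ≤ n → StabSub (I n) := fun n hn =>
    stableRing_sub hs _ (hI0 n hn) (frSub_mono (cS_le_one _) frSub_one)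
  have hUE : ∀ n, n0 ≤ n → I n / I n ≤ E := by
    intro n hn
    rw [hE, Submodule.le_div_iff_mul_le]
    calc I n / I n * T ≤ I n / I n * (I n * E) := by gcongr; exact hTI n hn
      _ = I n / I n * I n * E := by ring
      _ ≤ T * E := by gcongr; exact (UU_mul_self _).trans (hIT n)
      _ = T / T * T := by rw [mul_comm]
      _ ≤ T := UU_mul_self T
  have hUU : ∀ n m, n0 ≤ n → n ≤ m → I n / I n ≤ I m / I m := by
    intro n m hn hnm
    apply lemmaL' (hImono hnm) (hIst m (hn.trans hnm))
    calc I m ≤ T := hIT m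
      _ ≤ I n * E := hTI n hn
      _ ≤ _ := by gcongr
  have hdiv : ∀ n, n0 ≤ n → 1 / (1 / I n) = I n := by
    intro n hn
    have : f n ≠ ⊥ := by
      intro h
      apply hI0 n hn
      simp [hI, h]
    exact (isDivisorial_iff this).1 (hf n)
  set A : ℕ → Submodule R (FractionRing R) := fun n => 1 / I n with hA
  have hAanti : ∀ n m, n ≤ m → A m ≤ A n := fun n m h => one_div_anti (hImono h)
  have hA1 : ∀ n, 1 ≤ A n := fun n => Submodule.one_le_one_div.2 (cS_le_one _)
  have hA0 : ∀ n, A n ≠ ⊥ := fun n => (Submodule.ne_bot_iff _).2 ⟨1, Submodule.one_le.1 (hA1 n), one_ne_zero⟩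
  have hAU : ∀ n, n0 ≤ n → A n / A n = I n / I n := fun n hn => UU_one_div (hdiv n hn)
  have hAst : ∀ n, n0 ≤ n → StabSub (A n) := fun n hn =>
    stableRing_sub hs _ (hA0 n) (frSub_div (hI0 n hn) frSub_one)
  set G : Submodule R (FractionRing R) := 1 / T with hG
  have hGA : ∀ n, G ≤ A n := fun n => one_div_anti (hIT n)
  have h1G : (1 : FractionRing R) ∈ G := Submodule.one_le.1 (Submodule.one_le_one_div.2 hT1)
  set A' : ℕ → Submodule R (FractionRing R) := fun n => A n / A n / A n with hA'
  set D : ℕ → Submodule R (FractionRing R) := fun n => A' (n0 + n) * G with hD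
  have hA'mono : ∀ n m, n0 ≤ n → n ≤ m → A' n ≤ A' m := by
    intro n m hn hnm
    rw [hA']
    dsimp only
    rw [Submodule.le_div_iff_mul_le]
    calc A n / A n / A n * A m ≤ A n / A n / A n * A n := by gcongr; exact hAanti n m hnm
      _ ≤ A n / A n := div_mul_le _ _
      _ = I n / I n := hAU n hn
      _ ≤ I m / I m := hUU n m hn hnm
      _ = A m / A m := (hAU m (hn.trans hnm)).symm
  have hDmono : Monotone D := by
    intro a b hab
    rw [hD]
    dsimp only
    gcongr
    exact hA'mono _ _ (by omega) (by omega)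
  have hDE : ∀ n, D n ≤ E := by
    intro n
    calc A' (n0 + n) * G ≤ A' (n0 + n) * A (n0 + n) := by gcongr; exact hGA _
      _ ≤ A (n0 + n) / A (n0 + n) := div_mul_le _ _
      _ = I (n0 + n) / I (n0 + n) := hAU _ (by omega)
      _ ≤ E := hUE _ (by omega)
  set DD : Submodule R (FractionRing R) := ⨆ n, D n with hDD
  have hDDfr : FrSub DD := frSub_mono (iSup_le hDE) hEfr
  have hDD0 : DD ≠ ⊥ := by
    have h1 : A' (n0 + 0) ≠ ⊥ := by
      have := hAst (n0 + 0) (by omega)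
      rw [StabSub, mul_comm] at this
      exact ne_bot_of_one_mem_left this
    obtain ⟨x, hx, hx0⟩ := (Submodule.ne_bot_iff _).1 h1
    refine (Submodule.ne_bot_iff _).2 ⟨x * 1, ?_, by simpa using hx0⟩
    exact le_iSup D 0 (Submodule.mul_mem_mul hx h1G)
  have hDDst : StabSub DD := stableRing_sub hs DD hDD0 hDDfr
  obtain ⟨N, hN⟩ := mem_mul_of_chain hDmono hDDst
  have hDDB : DD / DD ≤ intCl R (FractionRing R) :=
    intLemma hfs (UU_mul_UU DD) (one_le_UU DD) (frSub_div hDD0 hDDfr)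
  have step : ∀ n, N ≤ n → f (n0 + n + 1) = f (n0 + n) := by
    intro n hn
    set p := n0 + n with hp
    have hp0 : n0 ≤ p := by omega
    have hp1 : n0 ≤ p + 1 := by omega
    have hUA : A p / A p ≤ A (p + 1) / A (p + 1) := by
      rw [hAU p hp0, hAU (p + 1) hp1]
      exact hUU _ _ hp0 (by omega)
    have hGE : A (p + 1) / A (p + 1) * G ≤ G := by
      rw [hG, Submodule.le_div_iff_mul_le]
      calc A (p + 1) / A (p + 1) * (1 / T) * T ≤ E * (1 / T) * T := by
            gcongr
            rw [hAU (p + 1) hp1]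
            exact hUE _ hp1
        _ = 1 / T * (T / T * T) := by rw [hE]; ring
        _ ≤ 1 / T * T := by gcongr; exact UU_mul_self T
        _ ≤ 1 := div_mul_le _ _
    set m := A' p * A (p + 1) with hm
    have hDm : D n ≤ m * D (n + 1) := by
      have h1 : (1 : FractionRing R) ∈ A (p + 1) * A' (p + 1) := hAst (p + 1) hp1
      apply le_of_one_mem_mul h1
      change A (p + 1) * A' (p + 1) * (A' p * G) ≤ A' p * A (p + 1) * (A' (p + 1) * G)
      apply le_of_eq
      ring
    have h1m : (1 : FractionRing R) ∈ m := by
      apply lying_over (one_le_UU (A p)) (UU_mul_UU (A p))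
      · calc A' p * A (p + 1) ≤ A' p * A p := by gcongr; exact hAanti _ _ (by omega)
          _ ≤ _ := div_mul_le _ _
      · calc A p / A p * (A' p * A (p + 1)) = A p / A p * A' p * A (p + 1) := by ring
          _ ≤ A' p * A (p + 1) := by gcongr; exact UU_mul_dual (A p)
      · have : D N * (DD / DD / DD) ≤ m * intCl R (FractionRing R) := by
          calc D N * (DD / DD / DD) ≤ D n * (DD / DD / DD) := by gcongr; exact hDmono hn
            _ ≤ m * D (n + 1) * (DD / DD / DD) := by gcongr
            _ ≤ m * DD * (DD / DD / DD) := by gcongr; exact le_iSup D (n + 1)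
            _ = m * ((DD / DD / DD) * DD) := by ring
            _ ≤ m * (DD / DD) := by gcongr; exact div_mul_le _ _
            _ ≤ _ := by gcongr
        exact this hN
    have hAA : A p ≤ A (p + 1) := by
      apply le_of_one_mem_mul h1m
      calc A' p * A (p + 1) * A p = (A' p * A p) * A (p + 1) := by ring
        _ ≤ A p / A p * A (p + 1) := by gcongr; exact div_mul_le _ _
        _ ≤ A (p + 1) / A (p + 1) * A (p + 1) := by gcongr
        _ ≤ A (p + 1) := UU_mul_self _
    have hII : I (p + 1) ≤ I p := by
      rw [← hdiv p hp0, ← hdiv (p + 1) hp1]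
      exact one_div_anti hAA
    exact le_antisymm (of_cS_le hII) (f.mono (by omega))
  refine ⟨n0 + N, fun m hm => ?_⟩
  obtain ⟨j, rfl⟩ := Nat.exists_eq_add_of_le hm
  clear hm
  induction j with
  | zero => rfl
  | succ j ih =>
    rw [← ih]
    have := step (N + j) (by omega)
    convert this using 2 <;> omega

end Bridge
section Converse

variable {R : Type*} [CommRing R] [IsDomain R]

theorem mori_max (hM : MoriRing R) (S : Set (Submodule R (FractionRing R))) (hne : S.Nonempty)
    (hS : ∀ D ∈ S, D ≠ ⊥ ∧ D ≤ 1 ∧ 1 / (1 / D) = D) :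
    ∃ D ∈ S, ∀ D' ∈ S, D ≤ D' → D' = D := by
  by_contra hcon
  push Not at hcon
  choose g hgS hgle hgne using hcon
  obtain ⟨D0, hD0⟩ := hne
  let G : S → S := fun D => ⟨g D.1 D.2, hgS D.1 D.2⟩
  let s : ℕ → S := fun n => G^[n] ⟨D0, hD0⟩
  have hs : ∀ n, s (n + 1) = G (s n) := fun n => Function.iterate_succ_apply' _ _ _
  have hmono : Monotone fun n => (s n).1 := by
    apply monotone_nat_of_le_succ
    intro n
    rw [hs]
    exact hgle _ _
  choose I hI using fun n => exists_cS (hS _ (s n).2).2.1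
  have hI0 : ∀ n, I n ≠ ⊥ := by
    intro n h0
    apply (hS _ (s n).2).1
    rw [← hI, h0]
    simp [cS]
  obtain ⟨n, hn⟩ := hM ⟨I, fun a b hab => of_cS_le (by rw [hI, hI]; exact hmono hab)⟩ (by
    intro n
    change (I n).IsDivisorial
    rw [isDivisorial_iff (hI0 n), hI]
    exact (hS _ (s n).2).2.2)
  have h1 : I (n + 1) = I n := hn (n + 1) (by omega)
  have h2 : (s (n + 1)).1 = (s n).1 := by rw [← hI, ← hI, h1]
  rw [hs] at h2
  exact hgne _ _ h2

theorem stab_mul_inv {Y : Submodule R (FractionRing R)} (h : StabSub Y) :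
    Y * (1 / Y) = 1 / (Y / Y) := by
  apply le_antisymm
  · rw [Submodule.le_div_iff_mul_le]
    calc Y * (1 / Y) * (Y / Y) = (1 / Y) * (Y / Y * Y) := by ring
      _ ≤ 1 / Y * Y := by gcongr; exact UU_mul_self Y
      _ ≤ 1 := div_mul_le _ _
  · apply le_of_one_mem_mul h
    have h1 : (Y / Y / Y) * (1 / (Y / Y)) ≤ 1 / Y := by
      rw [Submodule.le_div_iff_mul_le]
      calc (Y / Y / Y) * (1 / (Y / Y)) * Y = 1 / (Y / Y) * ((Y / Y / Y) * Y) := by ring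
        _ ≤ 1 / (Y / Y) * (Y / Y) := by gcongr; exact div_mul_le _ _
        _ ≤ 1 := div_mul_le _ _
    rw [mul_assoc]
    gcongr

theorem stable_of_fin_mori [Ring.DimensionLEOne R] (hF : FinitelyStableRing R) (hM : MoriRing R) :
    StableRing R := by
  intro I hI0
  rw [isStable_iff hI0]
  have hfs := finStableRing_sub hF
  have hII1 : cS I ≤ 1 := cS_le_one I
  obtain ⟨w, hw, hw0⟩ := (Submodule.ne_bot_iff _).1 (cS_ne_bot hI0)
  generalize cS I = II at *
  have nb : ∀ {X Y : Submodule R (FractionRing R)}, X ≤ Y → X ≠ ⊥ → Y ≠ ⊥ := by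
    rintro X Y h h1 rfl
    exact h1 (le_bot_iff.1 h)
  -- Step 1
  obtain ⟨_, ⟨X1, ⟨hX1fg, hX1b, hX1le⟩, rfl⟩, hX1m⟩ := mori_max hM
    ((fun X => 1 / (1 / X)) '' {X | X.FG ∧ X ≠ ⊥ ∧ X ≤ II})
    ⟨_, Submodule.span R {w}, ⟨Submodule.fg_span_singleton _, by simpa using hw0,
      by simpa [Submodule.span_le] using hw⟩, rfl⟩ (by
    rintro _ ⟨X, ⟨hfg, hb, hle⟩, rfl⟩
    refine ⟨nb (le_one_div_one_div X) hb, ?_, one_div_triple _⟩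
    have : (1 : Submodule R (FractionRing R)) ≤ 1 / X := by
      rw [Submodule.le_div_iff_mul_le, one_mul]
      exact hle.trans hII1
    calc 1 / (1 / X) ≤ 1 / 1 := one_div_anti this
      _ = 1 / 1 * 1 := by rw [mul_one]
      _ ≤ 1 := div_mul_le _ _)
  have hA : ∀ Y : Submodule R (FractionRing R), Y.FG → X1 ≤ Y → Y ≤ II → 1 / Y = 1 / X1 := by
    intro Y hfg h1 h2
    have := hX1m (1 / (1 / Y)) ⟨Y, ⟨hfg, nb h1 hX1b, h2⟩, rfl⟩ (one_div_anti (one_div_anti h1))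
    rw [← one_div_triple Y, this]
    exact one_div_triple X1
  set A := 1 / X1 with hAdef
  -- Step 2
  have hYA : ∀ Y : Submodule R (FractionRing R), Y.FG → X1 ≤ Y → Y ≤ II → Y * A = 1 / (Y / Y) := by
    intro Y hfg h1 h2
    rw [← hA Y hfg h1 h2]
    exact stab_mul_inv (hfs Y (nb h1 hX1b) hfg)
  have hAb : A ≠ ⊥ := one_div_ne_bot (frSub_of_fg hX1fg)
  obtain ⟨_, ⟨X, ⟨hXfg, hX1X, hXle⟩, rfl⟩, hXm⟩ := mori_max hM
    ((fun Y => Y * A) '' {Y | Y.FG ∧ X1 ≤ Y ∧ Y ≤ II})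
    ⟨_, X1, ⟨hX1fg, le_rfl, hX1le⟩, rfl⟩ (by
    rintro _ ⟨Y, ⟨hfg, h1, h2⟩, rfl⟩
    refine ⟨?_, ?_, ?_⟩
    · exact mul_ne_zero (nb h1 hX1b) hAb
    · change Y * A ≤ 1
      rw [← hA Y hfg h1 h2]
      exact Submodule.mul_one_div_le_one
    · change 1 / (1 / (Y * A)) = Y * A
      rw [hYA Y hfg h1 h2]
      exact one_div_triple _)
  have hXb := nb hX1X hX1b
  have hXs := hfs X hXb hXfg
  have hF' : A / A ≤ intCl R (FractionRing R) :=
    intLemma hfs (UU_mul_UU A) (one_le_UU A) (frSub_div hAb (frSub_div hX1b frSub_one))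
  have key : ∀ Y : Submodule R (FractionRing R), Y.FG → X ≤ Y → Y ≤ II →
      Y ≤ X * intCl R (FractionRing R) := by
    intro Y hfg h1 h2
    have e : Y * A = X * A := hXm _ ⟨Y, ⟨hfg, hX1X.trans h1, h2⟩, rfl⟩ (by
      change X * A ≤ Y * A
      gcongr)
    have hXX : X / X * A ≤ A := by
      rw [← hA X hXfg hX1X hXle, Submodule.le_div_iff_mul_le]
      calc X / X * (1 / X) * X = 1 / X * (X / X * X) := by ring
        _ ≤ 1 / X * X := by gcongr; exact UU_mul_self X
        _ ≤ 1 := div_mul_le _ _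
    have h3 : X / X / X * Y ≤ A / A := by
      rw [Submodule.le_div_iff_mul_le]
      calc X / X / X * Y * A = X / X / X * (Y * A) := by ring
        _ = X / X / X * X * A := by rw [e]; ring
        _ ≤ X / X * A := by gcongr; exact div_mul_le _ _
        _ ≤ A := hXX
    apply le_of_one_mem_mul hXs
    rw [mul_assoc]
    gcongr
    exact h3.trans hF'
  have fin : X / X / X ≤ II / II / II := by
    intro x hx y hy i hi
    change x * y * i ∈ II
    set Y := X ⊔ Submodule.span R {y, i} with hY
    have hYfg : Y.FG := hXfg.sup (Submodule.fg_span (by simp))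
    have hYle : Y ≤ II := by
      refine sup_le hXle (Submodule.span_le.2 ?_)
      rintro z (rfl | rfl)
      · exact hy
      · exact hi
    have hXY : X ≤ Y := le_sup_left
    have hyY : y ∈ Y := (le_sup_right : _ ≤ Y) (Submodule.subset_span (by simp))
    have hiY : i ∈ Y := (le_sup_right : _ ≤ Y) (Submodule.subset_span (by simp))
    have hYs := hfs Y (nb hXY hXb) hYfg
    have l1 := lemmaL hXY hYs (key Y hYfg hXY hYle)
    have l2 := lemmaL' hXY hYs (key Y hYfg hXY hYle)
    have l3 : X / X / X * Y ≤ Y / Y := by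
      calc X / X / X * Y ≤ X / X / X * (X * (Y / Y)) := by gcongr
        _ = X / X / X * X * (Y / Y) := by ring
        _ ≤ X / X * (Y / Y) := by gcongr; exact div_mul_le _ _
        _ ≤ Y / Y * (Y / Y) := by gcongr
        _ ≤ _ := UU_mul_UU Y
    exact hYle (l3 (Submodule.mul_mem_mul hx hyY) i hiY)
  exact (mul_le_mul' hXle fin : X * (X / X / X) ≤ II * (II / II / II)) hXs

theorem dimLEOne_of_fin_mori (hF : FinitelyStableRing R) (hM : MoriRing R) :
    Ring.DimensionLEOne R := by
  refine ⟨fun {P} hP0 hP => ?_⟩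
  by_contra hnm
  obtain ⟨M, hMmax, hPM⟩ := P.exists_le_maximal hP.ne_top
  obtain ⟨x, hxM, hxP⟩ : ∃ x ∈ M, x ∉ P := by
    by_contra h
    push Not at h
    exact hnm (le_antisymm hPM h ▸ hMmax)
  obtain ⟨p, hpP, hp0⟩ := (Submodule.ne_bot_iff _).1 hP0
  let φ := algebraMap R (FractionRing R)
  have hφ : Function.Injective φ := IsFractionRing.injective R (FractionRing R)
  have hφp : φ p ≠ 0 := by simpa [φ] using hp0
  let H : ℕ → Ideal R := fun n =>
    Submodule.comap (LinearMap.toSpanSingleton R R (x ^ n)) (Ideal.span {p})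
  have memH : ∀ n r, r ∈ H n ↔ p ∣ r * x ^ n := by
    intro n r
    simp [H, Ideal.mem_span_singleton]
  have hHm : Monotone H := by
    intro a b hab r hr
    rw [memH] at hr ⊢
    exact hr.trans (mul_dvd_mul_left r (pow_dvd_pow x hab))
  have hH0 : ∀ n, H n ≠ ⊥ := fun n =>
    (Submodule.ne_bot_iff _).2 ⟨p, (memH n p).2 (dvd_mul_right _ _), hp0⟩
  have hHc : ∀ n, cS (H n) = 1 / Submodule.span R {1, φ x ^ n / φ p} := by
    intro n
    ext z
    constructor
    · rintro ⟨r, hr, rfl⟩ y hy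
      obtain ⟨a, b, rfl⟩ := Submodule.mem_span_pair.1 hy
      obtain ⟨c, hc⟩ := (memH n r).1 hr
      refine Submodule.mem_one.2 ⟨r * a + b * c, ?_⟩
      have hc' : φ r * φ x ^ n = φ p * φ c := by rw [← map_pow, ← map_mul, ← map_mul, hc]
      change φ _ = φ r * (a • 1 + b • (φ x ^ n / φ p))
      rw [Algebra.smul_def, Algebra.smul_def, map_add, map_mul, map_mul]
      change _ = φ r * (φ a * 1 + φ b * (φ x ^ n / φ p))
      field_simp
      linear_combination (- φ b) * hc'
    · intro hz
      have h1 : z * 1 ∈ (1 : Submodule R (FractionRing R)) :=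
        hz _ (Submodule.subset_span (by simp))
      have h2 : z * (φ x ^ n / φ p) ∈ (1 : Submodule R (FractionRing R)) :=
        hz _ (Submodule.subset_span (by simp))
      obtain ⟨r, hr⟩ := Submodule.mem_one.1 h1
      obtain ⟨c, hc⟩ := Submodule.mem_one.1 h2
      rw [mul_one] at hr
      refine ⟨r, (memH n r).2 ⟨c, hφ ?_⟩, hr⟩
      change φ r = z at hr
      change φ c = _ at hc
      rw [map_mul, map_mul, map_pow, hr, hc]
      field_simp
  obtain ⟨n0, hn0⟩ := hM ⟨H, hHm⟩ (by
    intro n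
    change (H n).IsDivisorial
    rw [isDivisorial_iff (hH0 n), hHc]
    exact one_div_triple _)
  have hst : ∀ m r, p ∣ r * x ^ m → p ∣ r * x ^ n0 := by
    intro m r h
    rw [← memH] at h ⊢
    rcases le_total m n0 with h1 | h1
    · exact hHm h1 h
    · have e : H m = H n0 := hn0 m h1
      rwa [e] at h
  set n := 2 * n0 + 1 with hn
  set J := Submodule.span R {φ p, φ x ^ n} with hJ
  have hpJ : φ p ∈ J := Submodule.subset_span (by simp)
  have hxJ : φ x ^ n ∈ J := Submodule.subset_span (by simp)
  have hJ1 : ∀ z ∈ J, ∃ r, φ r = z := by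
    intro z hz
    obtain ⟨a, b, rfl⟩ := Submodule.mem_span_pair.1 hz
    refine ⟨a * p + b * x ^ n, ?_⟩
    rw [Algebra.smul_def, Algebra.smul_def, map_add, map_mul, map_mul, map_pow]
  have hJs : StabSub J := finStableRing_sub hF J
    ((Submodule.ne_bot_iff _).2 ⟨_, hpJ, hφp⟩) (Submodule.fg_span (by simp))
  obtain ⟨α, hα, β, hβ, hαβ⟩ : ∃ α ∈ J / J / J, ∃ β ∈ J / J / J, α * φ p + β * φ x ^ n = 1 := by
    have h := hJs
    rw [StabSub] at h
    have e : J = Submodule.span R {φ p} ⊔ Submodule.span R {φ x ^ n} := by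
      rw [hJ, Submodule.span_insert]
    nth_rewrite 1 [e] at h
    rw [Submodule.sup_mul] at h
    obtain ⟨u, hu, v, hv, huv⟩ := Submodule.mem_sup.1 h
    obtain ⟨α, hα, rfl⟩ := Submodule.mem_span_singleton_mul.1 hu
    obtain ⟨β, hβ, rfl⟩ := Submodule.mem_span_singleton_mul.1 hv
    exact ⟨α, hα, β, hβ, by rw [← huv]; ring⟩
  -- elements of T
  have hT : ∀ t ∈ J / J, ∃ r, φ r = t * φ x ^ n0 := by
    intro t ht
    obtain ⟨u, hu⟩ := hJ1 _ (ht _ hpJ)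
    obtain ⟨v, hv⟩ := hJ1 _ (ht _ hxJ)
    change φ u = t * φ p at hu
    change φ v = t * φ x ^ n at hv
    obtain ⟨c, hc⟩ := hst n u ⟨v, hφ (by rw [map_mul, map_mul, map_pow, hu, hv]; ring)⟩
    refine ⟨c, mul_left_cancel₀ hφp ?_⟩
    rw [← map_mul, ← hc, map_mul, map_pow, hu]
    ring
  obtain ⟨y, hy⟩ := hT _ (hβ _ hpJ)
  obtain ⟨a, ha⟩ := hT _ (hβ _ hxJ)
  change φ y = β * φ p * φ x ^ n0 at hy
  change φ a = β * φ x ^ n * φ x ^ n0 at ha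
  obtain ⟨r, hr⟩ := hst n y ⟨a, hφ (by rw [map_mul, map_mul, map_pow, hy, ha]; ring)⟩
  have hr' : φ r = β * φ x ^ (2 * n0) := by
    apply mul_left_cancel₀ hφp
    rw [← map_mul, ← hr, map_mul, map_pow, hy]
    ring
  have hb : α * φ x ^ n ∈ J / J := hα _ hxJ
  have hbb : (α * φ x ^ n) * (α * φ x ^ n) ∈ J / J := UU_mul_UU J (Submodule.mul_mem_mul hb hb)
  obtain ⟨c, hc⟩ := hJ1 _ (hbb _ hpJ)
  change φ c = (α * φ x ^ n) * (α * φ x ^ n) * φ p at hc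
  have hαp : α * φ p = φ (1 - r * x) := by
    rw [map_sub, map_one, map_mul, hr', ← hαβ, hn]
    ring
  have hsq : ((1 - r * x) * x ^ n) ^ 2 = p * c := by
    apply hφ
    rw [map_pow, map_mul, ← hαp, map_mul, hc, map_pow]
    ring
  have h1 : (1 - r * x) * x ^ n ∈ P :=
    hP.mem_of_pow_mem 2 (hsq ▸ P.mul_mem_right c hpP)
  have h2 : 1 - r * x ∈ P := by
    rcases hP.mem_or_mem h1 with h | h
    · exact h
    · exact absurd (hP.mem_of_pow_mem n h) hxP
  apply hMmax.ne_top
  rw [Ideal.eq_top_iff_one]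
  have := M.add_mem (hPM h2) (M.mul_mem_left r hxM)
  simpa using this

end Converse

theorem stable_mori_tfae (R : Type*) [CommRing R] [IsDomain R] (hR : ¬ IsField R) :
    ((ringKrullDim R = 1 ∧ StableRing R) ↔ (FinitelyStableRing R ∧ MoriRing R)) ∧
    ((FinitelyStableRing R ∧ MoriRing R) ↔ (StableRing R ∧ MoriRing R)) := by
  have hsf : StableRing R → FinitelyStableRing R := fun h I hI _ => h I hI
  have hfs : FinitelyStableRing R → MoriRing R → StableRing R := fun h1 h2 => by
    haveI := dimLEOne_of_fin_mori h1 h2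
    exact stable_of_fin_mori h1 h2
  refine ⟨⟨fun ⟨hd, hs⟩ => ?_, fun ⟨h1, h2⟩ => ?_⟩,
    fun ⟨h1, h2⟩ => ⟨hfs h1 h2, h2⟩, fun ⟨h1, h2⟩ => ⟨hsf h1, h2⟩⟩
  · have hk : Ring.KrullDimLE 1 R := Ring.krullDimLE_iff.2 (by rw [hd]; rfl)
    haveI : Ring.DimensionLEOne R := by
      refine ⟨fun {P} hP0 hP => ?_⟩
      exact (Ring.krullDimLE_one_iff_of_isPrime_bot.1 hk) P hP0 hP
    exact ⟨hsf hs, mori_of_stable hs⟩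
  · haveI := dimLEOne_of_fin_mori h1 h2
    refine ⟨?_, hfs h1 h2⟩
    refine eq_of_le_of_not_lt (Ring.krullDimLE_iff (n := 1).mp ?_) fun h => ?_
    · exact Ring.krullDimLE_one_iff_of_isPrime_bot.2
        fun P hP0 hP => Ring.DimensionLEOne.maximalOfPrime hP0 hP
    · have : Ring.KrullDimLE 0 R :=
        Ring.krullDimLE_iff.mpr (ENat.WithBot.lt_add_one_iff.mp h)
      exact hR Ring.KrullDimLE.isField_of_isDomain
end
end

section
/- Let R be a local commutative integral domain with maximal ideal m that is not a field, such that R is finitely stable and m is stable. The following are equivalent: (a) ⋂_{n ∈ ℕ} mⁿ = {0}; (b) R is a BF-domain; (c) R satisfies the ACCP; (d) R is archimedean. -/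
noncomputable section

open scoped nonZeroDivisors Pointwise

set_option synthInstance.maxHeartbeats 1000000
set_option maxHeartbeats 1000000

/-- A domain is *atomic* if every nonzero nonunit is a finite product of irreducible
elements. -/
def AtomicRing (R : Type*) [CommRing R] : Prop :=
  ∀ a : R, a ≠ 0 → ¬ IsUnit a →
    ∃ s : Multiset R, (∀ b ∈ s, Irreducible b) ∧ s.prod = a

/-- A domain is a *BF-domain* if it is atomic and every nonzero nonunit has a finite set of
lengths of factorizations into irreducible elements. -/
def BFRing (R : Type*) [CommRing R] : Prop :=
  AtomicRing R ∧ ∀ a : R, a ≠ 0 → ¬ IsUnit a →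
    {n : ℕ | ∃ s : Multiset R, Multiset.card s = n ∧ (∀ b ∈ s, Irreducible b) ∧ s.prod = a}.Finite

open FractionalIdeal in
/-- A finitely generated stable ideal of a local domain is principal over its endomorphism ring. -/
theorem fgStable_aux {R : Type*} [CommRing R] [IsDomain R] [IsLocalRing R] (I : Ideal R)
    (h0 : I ≠ ⊥) (hfg : I.FG) (hs : I.IsStableIdeal) :
    ∃ x ∈ I, (I : FractionalIdeal R⁰ (FractionRing R)) ≤
      spanSingleton R⁰ (algebraMap R (FractionRing R) x) *
        ((I : FractionalIdeal R⁰ (FractionRing R)) / (I : FractionalIdeal R⁰ (FractionRing R))) := by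
  unfold Ideal.IsStableIdeal at hs
  set K := FractionRing R
  set J : FractionalIdeal R⁰ K := (I : FractionalIdeal R⁰ K) with hJ
  have hJ0 : J ≠ 0 := coeIdeal_ne_zero.mpr h0
  let T : Subalgebra R K :=
    { carrier := {z | z ∈ J / J}
      mul_mem' := by
        intro a b ha hb
        simp only [Set.mem_setOf_eq, mem_div_iff_of_ne_zero hJ0] at *
        intro y hy
        rw [mul_assoc]
        exact ha _ (hb _ hy)
      add_mem' := by
        intro a b ha hb
        exact (J / J : FractionalIdeal R⁰ K).coeToSubmodule.add_mem ha hb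
      algebraMap_mem' := by
        intro r
        simp only [Set.mem_setOf_eq, mem_div_iff_of_ne_zero hJ0]
        intro y hy
        rw [← Algebra.smul_def]
        exact J.coeToSubmodule.smul_mem r hy }
  have memT : ∀ z, z ∈ T ↔ z ∈ J / J := fun z => Iff.rfl
  have memT' : ∀ z, z ∈ T ↔ ∀ y ∈ J, z * y ∈ J := fun z => mem_div_iff_of_ne_zero hJ0
  let A : Submodule T K :=
    { carrier := {z | z ∈ J}
      add_mem' := fun ha hb => J.coeToSubmodule.add_mem ha hb
      zero_mem' := J.coeToSubmodule.zero_mem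
      smul_mem' := fun c x hx => (memT' c.1).1 c.2 x hx }
  let B : Submodule T K :=
    { carrier := {z | z ∈ J / J / J}
      add_mem' := fun ha hb => (J / J / J : FractionalIdeal R⁰ K).coeToSubmodule.add_mem ha hb
      zero_mem' := (J / J / J : FractionalIdeal R⁰ K).coeToSubmodule.zero_mem
      smul_mem' := by
        intro c x hx
        simp only [Set.mem_setOf_eq] at *
        rw [mem_div_iff_of_ne_zero hJ0] at *
        intro y hy
        have := T.mul_mem c.2 (hx y hy)
        rw [← mul_assoc] at this
        exact this }
  have memA : ∀ z, z ∈ A ↔ z ∈ J := fun z => Iff.rfl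
  have memB : ∀ z, z ∈ B ↔ z ∈ J / J / J := fun z => Iff.rfl
  have oneT : (1 : K) ∈ J * (J / J / J) := by
    rw [hs]; exact T.one_mem
  have hAB : A * B = 1 := by
    apply le_antisymm
    · rw [Submodule.mul_le]
      intro a ha b hb
      rw [Submodule.mem_one]
      have : a * b ∈ J * (J / J / J) := mul_mem_mul ha hb
      rw [hs] at this
      exact ⟨⟨a * b, this⟩, rfl⟩
    · rw [Submodule.one_le]
      have key : ∀ z ∈ J * (J / J / J), z ∈ A * B := by
        intro z hz
        refine FractionalIdeal.mul_induction_on hz ?_ ?_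
        · intro i hi j hj
          exact Submodule.mul_mem_mul hi hj
        · intro x y hx hy
          exact add_mem hx hy
      exact key 1 oneT
  -- `T` is a finite `R`-module
  have hJfg : (J : Submodule R K).FG := by
    rw [hJ, coe_coeIdeal]
    exact Submodule.FG.map _ hfg
  have hTfg : (Subalgebra.toSubmodule T).FG := by
    have key : ∀ z ∈ J * (J / J / J), ∃ N : Submodule R K, N.FG ∧ N ≤ Subalgebra.toSubmodule T ∧
        ∀ t ∈ T, t * z ∈ N := by
      intro z hz
      refine FractionalIdeal.mul_induction_on hz ?_ ?_
      · intro i hi j hj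
        refine ⟨(J : Submodule R K).map (LinearMap.mulRight R j), hJfg.map _, ?_, ?_⟩
        · rintro _ ⟨y, hy, rfl⟩
          have h1 : y * j ∈ J * (J / J / J) := mul_mem_mul hy hj
          rw [hs] at h1
          exact h1
        · intro t ht
          refine ⟨t * i, (memT' t).1 ht i hi, ?_⟩
          simp [mul_assoc]
      · rintro x y ⟨N, hN, hN', hN''⟩ ⟨M, hM, hM', hM''⟩
        refine ⟨N ⊔ M, hN.sup hM, sup_le hN' hM', ?_⟩
        intro t ht
        rw [mul_add]
        exact Submodule.add_mem_sup (hN'' t ht) (hM'' t ht)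
    obtain ⟨N, hN, hN', hN''⟩ := key 1 oneT
    have : N = Subalgebra.toSubmodule T := le_antisymm hN' (fun t ht => by simpa using hN'' t ht)
    rwa [← this]
  haveI : Module.Finite R T := Module.Finite.iff_fg.mpr hTfg
  have hfin : {P : Ideal T | P.IsMaximal}.Finite := by
    refine (Algebra.QuasiFinite.finite_primesOver (S := T) (IsLocalRing.maximalIdeal R)).subset ?_
    intro P hP
    have hP' : P.IsMaximal := hP
    refine ⟨hP'.isPrime, ⟨?_⟩⟩
    have : (P.under R).IsMaximal := inferInstance
    exact (IsLocalRing.eq_maximalIdeal this).symm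
  haveI : IsFractionRing T K := by
    refine IsFractionRing.of_field T K fun z ↦ ?_
    obtain ⟨a, b, hb, rfl⟩ := IsFractionRing.div_surjective (A := R) z
    exact ⟨algebraMap R T a, algebraMap R T b, rfl⟩
  have hprin : A.IsPrincipal := by
    have hx : IsFractional T⁰ A := by
      refine ⟨1, one_mem _, ?_⟩
      intro a ha
      obtain ⟨r, hr, rfl⟩ := (mem_coeIdeal R⁰).1 ((memA a).1 ha)
      exact ⟨algebraMap R T r, by rw [one_smul]; rfl⟩
    have hA0 : A ≠ ⊥ := by
      intro h
      rw [h, Submodule.bot_mul] at hAB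
      exact one_ne_zero hAB.symm
    obtain ⟨a, ha, ha0⟩ := Submodule.exists_mem_ne_zero_of_ne_bot hA0
    have hy : IsFractional T⁰ B := by
      obtain ⟨r, hr, hra⟩ := (mem_coeIdeal R⁰).1 ((memA a).1 ha)
      refine ⟨algebraMap R T r, ?_, ?_⟩
      · rw [mem_nonZeroDivisors_iff_ne_zero]
        intro h
        apply ha0
        rw [← hra]
        exact congrArg (Subtype.val) h
      · intro b hb
        have h2 : a * b ∈ A * B := Submodule.mul_mem_mul ha hb
        rw [hAB, Submodule.mem_one] at h2
        obtain ⟨y, hy⟩ := h2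
        refine ⟨y, ?_⟩
        rw [hy, ← hra]
        rfl
    have := FractionalIdeal.isPrincipal.of_finite_maximals_of_inv (S := T⁰) le_rfl hfin
      (⟨A, hx⟩ : FractionalIdeal T⁰ K) (⟨B, hy⟩ : FractionalIdeal T⁰ K)
      (by
        apply FractionalIdeal.coeToSubmodule_injective
        exact (FractionalIdeal.coe_mul _ _).trans (hAB.trans FractionalIdeal.coe_one.symm))
    exact this
  obtain ⟨x, hx⟩ := hprin
  have hxA : x ∈ A := by rw [hx]; exact Submodule.mem_span_singleton_self x
  obtain ⟨r, hr, rfl⟩ := (mem_coeIdeal R⁰).1 ((memA x).1 hxA)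
  refine ⟨r, hr, ?_⟩
  intro y hy
  have hyA : y ∈ A := hy
  rw [hx, Submodule.mem_span_singleton] at hyA
  obtain ⟨t, rfl⟩ := hyA
  rw [mem_singleton_mul]
  exact ⟨t.1, t.2, by rw [mul_comm]; rfl⟩

open FractionalIdeal in
theorem maxStable_aux {R : Type*} [CommRing R] [IsDomain R] [IsLocalRing R]
    (hR : ¬ IsField R) (hfs : FinitelyStableRing R)
    (hm : (IsLocalRing.maximalIdeal R).IsStableIdeal) :
    ∃ x ∈ IsLocalRing.maximalIdeal R, x ≠ 0 ∧
      IsLocalRing.maximalIdeal R * IsLocalRing.maximalIdeal R ≤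
        Ideal.span {x} * IsLocalRing.maximalIdeal R := by
  have hm0 : IsLocalRing.maximalIdeal R ≠ ⊥ := fun h => hR (IsLocalRing.isField_iff_maximalIdeal_eq.mpr h)
  unfold Ideal.IsStableIdeal at hm
  set m := IsLocalRing.maximalIdeal R
  set K := FractionRing R
  set J : FractionalIdeal R⁰ K := (m : FractionalIdeal R⁰ K) with hJ
  have hJ0 : J ≠ 0 := coeIdeal_ne_zero.mpr hm0
  have oneE : (1 : K) ∈ J * (J / J / J) := by
    rw [hm, mem_div_iff_of_ne_zero hJ0]
    intro y hy
    rwa [one_mul]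
  have hEJ : (J / J) * J ≤ J := (le_div_iff_mul_le hJ0).1 le_rfl
  have hEE : (J / J) * (J / J) ≤ J / J := by
    rw [le_div_iff_mul_le hJ0, mul_assoc]
    exact (mul_le_mul_right hEJ _).trans hEJ
  have key : ∀ z ∈ J * (J / J / J), ∃ I : Ideal R, I.FG ∧ I ≤ m ∧
      z ∈ (I : FractionalIdeal R⁰ K) * (J / J / J) := by
    intro z hz
    refine FractionalIdeal.mul_induction_on hz ?_ ?_
    · intro i hi j hj
      obtain ⟨r, hr, rfl⟩ := (mem_coeIdeal R⁰).1 hi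
      refine ⟨Ideal.span {r}, ⟨{r}, by simp⟩, by simpa [Ideal.span_le] using hr, ?_⟩
      exact mul_mem_mul (mem_coeIdeal_of_mem _ (Ideal.mem_span_singleton_self r)) hj
    · rintro x y ⟨N, hN, hN', hN''⟩ ⟨M, hM, hM', hM''⟩
      refine ⟨N ⊔ M, Submodule.FG.sup hN hM, sup_le hN' hM', ?_⟩
      have h1 : (N : FractionalIdeal R⁰ K) * (J / J / J) ≤ ((N ⊔ M : Ideal R) : FractionalIdeal R⁰ K) * (J / J / J) :=
        mul_le_mul_left ((coeIdeal_le_coeIdeal K).2 le_sup_left) _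
      have h2 : (M : FractionalIdeal R⁰ K) * (J / J / J) ≤ ((N ⊔ M : Ideal R) : FractionalIdeal R⁰ K) * (J / J / J) :=
        mul_le_mul_left ((coeIdeal_le_coeIdeal K).2 le_sup_right) _
      exact (((N ⊔ M : Ideal R) : FractionalIdeal R⁰ K) * (J / J / J)).coeToSubmodule.add_mem (h1 hN'') (h2 hM'')
  obtain ⟨I, hIfg, hIm, hI1⟩ := key 1 oneE
  have hI0 : I ≠ ⊥ := by
    rintro rfl
    rw [coeIdeal_bot, zero_mul, mem_zero_iff] at hI1
    exact one_ne_zero hI1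
  have hIJ : (I : FractionalIdeal R⁰ K) ≤ J := (coeIdeal_le_coeIdeal K).2 hIm
  have hI0' : (I : FractionalIdeal R⁰ K) ≠ 0 := coeIdeal_ne_zero.mpr hI0
  have hone : (1 : FractionalIdeal R⁰ K) ≤ (I : FractionalIdeal R⁰ K) * (J / J / J) := by
    rw [← spanSingleton_one, spanSingleton_le_iff_mem]
    exact hI1
  have hJI : J ≤ (I : FractionalIdeal R⁰ K) * (J / J) := by
    calc J = 1 * J := (one_mul _).symm
      _ ≤ (I : FractionalIdeal R⁰ K) * (J / J / J) * J := mul_le_mul_left hone _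
      _ = (I : FractionalIdeal R⁰ K) * ((J / J / J) * J) := mul_assoc _ _ _
      _ ≤ _ := mul_le_mul_right ((le_div_iff_mul_le hJ0).1 le_rfl) _
  have hIE : (I : FractionalIdeal R⁰ K) * (J / J) ≤ J :=
    (mul_le_mul_left hIJ _).trans (by rw [mul_comm]; exact hEJ)
  obtain ⟨x, hxI, hx⟩ := fgStable_aux I hI0 hIfg (hfs I hI0 hIfg)
  have hTE : (I : FractionalIdeal R⁰ K) / (I : FractionalIdeal R⁰ K) ≤ J / J := by
    rw [le_div_iff_mul_le hJ0]
    refine (mul_le_mul_right hJI _).trans ?_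
    rw [← mul_assoc]
    exact (mul_le_mul_left ((le_div_iff_mul_le hI0').1 le_rfl) _).trans hIE
  have hJx : J ≤ spanSingleton R⁰ (algebraMap R K x) * (J / J) := by
    refine hJI.trans ((mul_le_mul_left (hx.trans (mul_le_mul_right hTE _)) _).trans ?_)
    rw [mul_assoc]
    exact mul_le_mul_right hEE _
  refine ⟨x, hIm hxI, ?_, ?_⟩
  · rintro rfl
    rw [map_zero, spanSingleton_zero, zero_mul] at hJx
    exact hJ0 (le_antisymm hJx (zero_le _))
  · rw [← coeIdeal_le_coeIdeal K, coeIdeal_mul, coeIdeal_mul, coeIdeal_span_singleton]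
    refine (mul_le_mul_left hJx _).trans ?_
    rw [mul_assoc]
    exact mul_le_mul_right hEJ _

theorem a_imp_b_aux {R : Type*} [CommRing R] [IsDomain R] [IsLocalRing R]
    (h : (⨅ n : ℕ, IsLocalRing.maximalIdeal R ^ (n + 1)) = ⊥) : BFRing R := by
  have hN : ∀ a : R, a ≠ 0 → ∃ n : ℕ, a ∉ IsLocalRing.maximalIdeal R ^ (n + 1) := by
    intro a ha
    by_contra! hc
    apply ha
    rw [← Ideal.mem_bot, ← h, Ideal.mem_iInf]
    exact hc
  constructor
  · have key : ∀ n : ℕ, ∀ a : R, a ≠ 0 → ¬ IsUnit a → a ∉ IsLocalRing.maximalIdeal R ^ (n + 1) →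
        ∃ s : Multiset R, (∀ b ∈ s, Irreducible b) ∧ s.prod = a := by
      intro n
      induction n with
      | zero =>
        intro a ha hu hn
        exact absurd (by simpa using hu) hn
      | succ n ih =>
        intro a ha hu hn
        by_cases hirr : Irreducible a
        · exact ⟨{a}, by simpa using hirr, by simp⟩
        · rw [irreducible_iff] at hirr
          push Not at hirr
          obtain ⟨b, c, rfl, hb, hc⟩ := hirr hu
          have hbm : b ∈ IsLocalRing.maximalIdeal R := hb
          have hcm : c ∈ IsLocalRing.maximalIdeal R := hc
          obtain ⟨s, hs, rfl⟩ := ih b (left_ne_zero_of_mul ha) hb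
            (fun hh => hn (by rw [pow_succ]; exact Ideal.mul_mem_mul hh hcm))
          obtain ⟨t, ht, rfl⟩ := ih c (right_ne_zero_of_mul ha) hc
            (fun hh => hn (by rw [pow_succ']; exact Ideal.mul_mem_mul hbm hh))
          refine ⟨s + t, ?_, by simp⟩
          intro b hb
          rcases Multiset.mem_add.1 hb with hb | hb
          · exact hs b hb
          · exact ht b hb
    intro a ha hu
    obtain ⟨n, hn⟩ := hN a ha
    exact key n a ha hu hn
  · intro a ha hu
    obtain ⟨n, hn⟩ := hN a ha
    refine (Set.finite_Iic n).subset ?_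
    rintro k ⟨s, rfl, hs, rfl⟩
    by_contra hk
    apply hn
    have h1 : s.prod ∈ IsLocalRing.maximalIdeal R ^ Multiset.card s := by
      clear ha hu hn hk
      induction s using Multiset.induction_on with
      | empty => simp
      | cons b s ih =>
        rw [Multiset.prod_cons, Multiset.card_cons, pow_succ']
        exact Ideal.mul_mem_mul (hs b (Multiset.mem_cons_self b s)).not_isUnit
          (ih fun c hc => hs c (Multiset.mem_cons_of_mem hc))
    exact Ideal.pow_le_pow_right (by simpa [Nat.succ_le_iff] using hk) h1

theorem b_imp_wf_aux {R : Type*} [CommRing R] [IsDomain R] (h : BFRing R) : WfDvdMonoid R := by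
  classical
  obtain ⟨hat, hbf⟩ := h
  let S : R → Set ℕ := fun a =>
    {n | ∃ s : Multiset R, Multiset.card s = n ∧ (∀ b ∈ s, Irreducible b) ∧ Associated s.prod a}
  have hSne : ∀ a, a ≠ 0 → (S a).Nonempty := by
    intro a ha
    by_cases hu : IsUnit a
    · exact ⟨0, 0, rfl, by simp, by simpa using (associated_one_iff_isUnit.2 hu).symm⟩
    · obtain ⟨s, hs, rfl⟩ := hat a ha hu
      exact ⟨_, s, rfl, hs, Associated.refl _⟩
  have hSb : ∀ a, a ≠ 0 → BddAbove (S a) := by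
    intro a ha
    by_cases hu : IsUnit a
    · refine ⟨0, ?_⟩
      rintro n ⟨s, rfl, hs, hsa⟩
      rcases Multiset.empty_or_exists_mem s with rfl | ⟨b, hb⟩
      · simp
      · have := hsa.isUnit_iff.2 hu
        exact absurd (isUnit_of_dvd_unit (Multiset.dvd_prod hb) this) (hs b hb).not_isUnit
    · refine (hbf a ha hu).bddAbove.mono ?_
      rintro n ⟨s, rfl, hs, u, hu'⟩
      rcases Multiset.empty_or_exists_mem s with rfl | ⟨b, hb⟩
      · exact absurd ⟨u, by simpa using hu'⟩ hu
      · obtain ⟨t, rfl⟩ := Multiset.exists_cons_of_mem hb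
        refine ⟨(b * u) ::ₘ t, by simp, ?_, ?_⟩
        · intro c hc
          rcases Multiset.mem_cons.1 hc with rfl | hc
          · exact (irreducible_mul_units u).2 (hs b hb)
          · exact hs c (Multiset.mem_cons_of_mem hc)
        · rw [← hu', Multiset.prod_cons, Multiset.prod_cons]; ring
  let L : R → ℕ∞ := fun a => if a = 0 then ⊤ else ((sSup (S a) : ℕ) : ℕ∞)
  constructor
  refine Subrelation.wf (r := InvImage (· < ·) L) ?_ (InvImage.wf L wellFounded_lt)
  rintro a b ⟨ha, c, hc, rfl⟩
  change L a < L (a * c)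
  simp only [L, if_neg ha]
  split_ifs with hac
  · exact ENat.coe_lt_top _
  · have hc0 : c ≠ 0 := right_ne_zero_of_mul hac
    obtain ⟨s, hs1, hs2, hs3⟩ := Nat.sSup_mem (hSne a ha) (hSb a ha)
    obtain ⟨t, ht, rfl⟩ := hat c hc0 hc
    have hmem : Multiset.card (s + t) ∈ S (a * t.prod) := by
      refine ⟨s + t, rfl, ?_, ?_⟩
      · intro b hb
        rcases Multiset.mem_add.1 hb with hb | hb
        · exact hs2 b hb
        · exact ht b hb
      · rw [Multiset.prod_add]
        exact hs3.mul_right _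
    have hle := le_csSup (hSb _ hac) hmem
    have htpos : 0 < Multiset.card t := by
      rw [Multiset.card_pos]
      rintro rfl
      simp at hc
    rw [Multiset.card_add] at hle
    exact_mod_cast (by omega : sSup (S a) < sSup (S (a * t.prod)))

theorem b_imp_c_aux {R : Type*} [CommRing R] [IsDomain R] (h : BFRing R) :
    ∀ f : ℕ →o Ideal R, (∀ n, (f n).IsPrincipal) → ∃ n, ∀ m, n ≤ m → f m = f n := by
  haveI := b_imp_wf_aux h
  intro f hf
  have hw := Ideal.setOfPred_isPrincipal_wellFoundedOn_gt (α := R)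
  obtain ⟨_, ⟨n, rfl⟩, hn⟩ := hw.has_min (Set.range fun n => (⟨f n, hf n⟩ : {I : Ideal R | I.IsPrincipal}))
    (Set.range_nonempty _)
  refine ⟨n, fun m hm => ?_⟩
  have h1 := hn _ ⟨m, rfl⟩
  have h2 : ¬ (f n < f m) := h1
  exact ((f.monotone hm).eq_of_not_lt h2).symm

theorem c_imp_d_aux {R : Type*} [CommRing R] [IsDomain R]
    (h : ∀ f : ℕ →o Ideal R, (∀ n, (f n).IsPrincipal) → ∃ n, ∀ m, n ≤ m → f m = f n) :
    ∀ a : R, a ≠ 0 → ¬ IsUnit a → (⨅ n : ℕ, Ideal.span {a ^ (n + 1)}) = ⊥ := by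
  intro a ha hu
  rw [eq_bot_iff]
  intro b hb
  by_contra hb0
  rw [Ideal.mem_bot] at hb0
  rw [Ideal.mem_iInf] at hb
  simp only [Ideal.mem_span_singleton] at hb
  choose c hc using hb
  have hstep : ∀ n, c n = a * c (n + 1) := by
    intro n
    apply mul_left_cancel₀ (pow_ne_zero (n + 1) ha)
    rw [← hc n, ← mul_assoc, ← pow_succ]
    exact hc (n + 1)
  obtain ⟨n, hn⟩ := h ⟨fun n => Ideal.span {c n}, monotone_nat_of_le_succ fun n => by
    rw [Ideal.span_singleton_le_span_singleton, hstep n]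
    exact Dvd.intro_left a rfl⟩ (fun n => ⟨⟨c n, rfl⟩⟩)
  have h1 : Ideal.span {c (n + 1)} = Ideal.span {c n} := hn (n + 1) (Nat.le_succ n)
  have h2 : c n ∣ c (n + 1) := Ideal.span_singleton_le_span_singleton.1 h1.le
  obtain ⟨r, hr⟩ := h2
  have hc0 : c n ≠ 0 := by
    intro h0
    apply hb0
    rw [hc n, h0, mul_zero]
  apply hu
  refine IsUnit.of_mul_eq_one r ?_
  apply mul_left_cancel₀ hc0
  rw [mul_one]
  calc c n * (a * r) = a * (c n * r) := by ring
    _ = c n := by rw [← hr, ← hstep]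

theorem d_imp_a_aux {R : Type*} [CommRing R] [IsDomain R] [IsLocalRing R]
    (hR : ¬ IsField R) (hfs : FinitelyStableRing R)
    (hm : (IsLocalRing.maximalIdeal R).IsStableIdeal)
    (h : ∀ a : R, a ≠ 0 → ¬ IsUnit a → (⨅ n : ℕ, Ideal.span {a ^ (n + 1)}) = ⊥) :
    (⨅ n : ℕ, IsLocalRing.maximalIdeal R ^ (n + 1)) = ⊥ := by
  obtain ⟨x, hxm, hx0, hx⟩ := maxStable_aux hR hfs hm
  have key : ∀ n : ℕ, IsLocalRing.maximalIdeal R ^ (n + 1) ≤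
      Ideal.span {x} ^ n * IsLocalRing.maximalIdeal R := by
    intro n
    induction n with
    | zero => simp
    | succ n ih =>
      rw [pow_succ]
      refine (Ideal.mul_mono_left ih).trans ?_
      rw [mul_assoc, pow_succ, mul_assoc]
      exact Ideal.mul_mono_right hx
  rw [eq_bot_iff, ← h x hx0 hxm]
  refine le_iInf fun n => (iInf_le _ (n + 1)).trans ((key (n + 1)).trans ?_)
  rw [Ideal.span_singleton_pow]
  exact Ideal.mul_le_left (I := Ideal.span {x ^ (n + 1)})
    (J := IsLocalRing.maximalIdeal R)

theorem finitely_stable_local_bf_tfae (R : Type*) [CommRing R] [IsDomain R] [IsLocalRing R]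
    (hR : ¬ IsField R) (hfs : FinitelyStableRing R)
    (hm : (IsLocalRing.maximalIdeal R).IsStableIdeal) :
    ((⨅ n : ℕ, IsLocalRing.maximalIdeal R ^ (n + 1)) = ⊥ ↔ BFRing R) ∧
    (BFRing R ↔
      ∀ f : ℕ →o Ideal R, (∀ n, (f n).IsPrincipal) → ∃ n, ∀ m, n ≤ m → f m = f n) ∧
    ((∀ f : ℕ →o Ideal R, (∀ n, (f n).IsPrincipal) → ∃ n, ∀ m, n ≤ m → f m = f n) ↔
      ∀ a : R, a ≠ 0 → ¬ IsUnit a → (⨅ n : ℕ, Ideal.span {a ^ (n + 1)}) = ⊥) := by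
  refine ⟨⟨a_imp_b_aux, fun h => ?_⟩, ⟨b_imp_c_aux, fun h => ?_⟩, ⟨c_imp_d_aux, fun h => ?_⟩⟩
  · exact d_imp_a_aux hR hfs hm (c_imp_d_aux (b_imp_c_aux h))
  · exact a_imp_b_aux (d_imp_a_aux hR hfs hm (c_imp_d_aux h))
  · exact b_imp_c_aux (a_imp_b_aux (d_imp_a_aux hR hfs hm h))
end
end

section
/- Let R be a local noetherian commutative integral domain with maximal ideal m such that R is not a field. Then R is divisorial if and only if R is one-dimensional and the R-module m⁻¹/R is simple, where m⁻¹ = {z ∈ K | zm ⊆ R} is an R-submodule of the quotient field K containing R. -/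
noncomputable section

open scoped nonZeroDivisors Pointwise

set_option synthInstance.maxHeartbeats 1000000
set_option maxHeartbeats 1000000

/-- A domain is *divisorial* if every nonzero ideal is divisorial. -/
def DivisorialRing (R : Type*) [CommRing R] [IsDomain R] : Prop :=
  ∀ I : Ideal R, I ≠ ⊥ → I.IsDivisorial

/-- The fractional ideal `m⁻¹ = {z ∈ K | z·m ⊆ R}`, as an `R`-submodule of the quotient
field. -/
def maxIdealInv (R : Type*) [CommRing R] [IsDomain R] [IsLocalRing R] :
    Submodule R (FractionRing R) :=
  ((1 / (IsLocalRing.maximalIdeal R : FractionalIdeal R⁰ (FractionRing R)) :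
    FractionalIdeal R⁰ (FractionRing R)) : Submodule R (FractionRing R))

/-- `R` itself, i.e. the fractional ideal `1`, as an `R`-submodule of the quotient field. -/
def oneSubmodule (R : Type*) [CommRing R] [IsDomain R] : Submodule R (FractionRing R) :=
  ((1 : FractionalIdeal R⁰ (FractionRing R)) : Submodule R (FractionRing R))


section Helpers

open FractionalIdeal

/-- In an Artinian local ring with socle of length at most one, consecutive annihilators differ
by length at most one. -/
lemma helper_cov {A : Type*} [CommRing A] [IsLocalRing A] [IsArtinianRing A]
    (hs : Module.length A (IsLocalRing.maximalIdeal A).annihilator ≤ 1)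
    {J J' : Ideal A} (h : J ⋖ J') :
    Module.length A J + Module.length A J.annihilator ≤
      Module.length A J' + Module.length A J'.annihilator := by
  obtain ⟨x, hx', hx⟩ := SetLike.exists_of_lt h.lt
  have key : ∀ y ∈ J', y ∉ J → J' ≤ J ⊔ Ideal.span {y} := by
    intro y hy hyJ
    have h1 : J < J ⊔ Ideal.span {y} := by
      refine lt_of_le_of_ne le_sup_left fun he => hyJ ?_
      rw [he]
      exact Ideal.mem_sup_right (Ideal.mem_span_singleton_self y)
    have h2 : J ⊔ Ideal.span {y} ≤ J' :=
      sup_le h.le ((Ideal.span_singleton_le_iff_mem _).2 hy)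
    rcases h2.lt_or_eq with h3 | h3
    · exact (h.2 h1 h3).elim
    · exact h3.ge
  have hmx : ∀ r ∈ IsLocalRing.maximalIdeal A, r * x ∈ J := by
    intro r hr
    by_contra hc
    have := key _ (J'.mul_mem_left r hx') hc hx'
    obtain ⟨j, hj, w, hw, e⟩ := Submodule.mem_sup.1 this
    obtain ⟨s, rfl⟩ := Ideal.mem_span_singleton'.1 hw
    have hu : IsUnit (1 - s * r) := by
      by_contra hn
      have h1 : 1 - s * r ∈ IsLocalRing.maximalIdeal A := hn
      have h2 := Ideal.add_mem _ h1 (Ideal.mul_mem_left _ s hr)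
      rw [sub_add_cancel] at h2
      exact (Ideal.ne_top_iff_one _).1 (IsLocalRing.maximalIdeal.isMaximal A).ne_top h2
    apply hx
    have : (1 - s * r) * x ∈ J := by
      have : (1 - s * r) * x = j := by linear_combination -e
      rwa [this]
    exact (Ideal.unit_mul_mem_iff_mem J hu).1 this
  let f : J.annihilator →ₗ[A] A := (LinearMap.mulRight A x).comp J.annihilator.subtype
  have hfapp : ∀ z, f z = z.1 * x := fun z => rfl
  have e1 : Module.length A J.annihilator =
      Module.length A (LinearMap.ker f) + Module.length A (LinearMap.range f) :=
    Module.length_eq_add_of_exact (LinearMap.ker f).subtype f.rangeRestrict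
      (Submodule.subtype_injective _) f.surjective_rangeRestrict (by
        intro z
        simp [Subtype.ext_iff])
  have e2 : Module.length A (LinearMap.range f) ≤ 1 := by
    refine le_trans ?_ hs
    rw [Module.length_submodule, Module.length_submodule]
    apply Order.height_mono
    rintro _ ⟨z, rfl⟩
    rw [Submodule.mem_annihilator]
    intro r hr
    rw [hfapp, smul_eq_mul, mul_assoc, mul_comm x r]
    exact Submodule.mem_annihilator.1 z.2 _ (hmx r hr)
  have e3 : Module.length A (LinearMap.ker f) ≤ Module.length A J'.annihilator := by
    have hin : ∀ z : LinearMap.ker f, (z.1 : A) ∈ J'.annihilator := by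
      intro z
      rw [Submodule.mem_annihilator]
      intro y hy
      obtain ⟨j, hj, w, hw, rfl⟩ := Submodule.mem_sup.1 (key x hx' hx hy)
      obtain ⟨s, rfl⟩ := Ideal.mem_span_singleton'.1 hw
      have h1 : z.1.1 * x = 0 := z.2
      have h2 : z.1.1 * j = 0 := Submodule.mem_annihilator.1 z.1.2 _ hj
      rw [smul_eq_mul]
      linear_combination h2 + s * h1
    refine Module.length_le_of_injective
      (LinearMap.codRestrict J'.annihilator
        (J.annihilator.subtype.comp (LinearMap.ker f).subtype) hin) ?_
    intro a b hab
    have := congrArg Subtype.val hab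
    exact Subtype.ext (Subtype.ext this)
  have e4 : Module.length A J + 1 ≤ Module.length A J' := by
    rw [Module.length_submodule, Module.length_submodule]
    exact Order.height_add_one_le h.lt
  calc _ ≤ Module.length A J + (Module.length A J'.annihilator + 1) := by
        rw [e1]; gcongr
    _ = (Module.length A J + 1) + Module.length A J'.annihilator := by
        rw [add_comm (Module.length A J'.annihilator), add_assoc]
    _ ≤ _ := by gcongr

lemma helper_mono {A : Type*} [CommRing A] [IsLocalRing A] [IsArtinianRing A]
    (hs : Module.length A (IsLocalRing.maximalIdeal A).annihilator ≤ 1)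
    (J' J : Ideal A) (h : J ≤ J') :
    Module.length A J + Module.length A J.annihilator ≤
      Module.length A J' + Module.length A J'.annihilator := by
  induction J' using WellFoundedLT.induction with
  | ind J' ih =>
    rcases h.lt_or_eq with h | rfl
    · obtain ⟨L, hL, hLJ⟩ := exists_le_covBy_of_lt h
      exact (ih L hLJ.lt hL).trans (helper_cov hs hLJ)
    · exact le_rfl

lemma helper_annann {A : Type*} [CommRing A] [IsLocalRing A] [IsArtinianRing A]
    (hs : Module.length A (IsLocalRing.maximalIdeal A).annihilator ≤ 1)
    (J : Ideal A) : J.annihilator.annihilator = J := by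
  have hc : ∀ J : Ideal A, Module.length A J + Module.length A J.annihilator =
      Module.length A A := by
    intro J
    apply le_antisymm
    · have := helper_mono hs ⊤ J le_top
      have e : Submodule.annihilator (⊤ : Ideal A) = ⊥ := by
        rw [eq_bot_iff]
        intro z hz
        simpa using Submodule.mem_annihilator.1 hz 1 Submodule.mem_top
      rw [e, Module.length_bot, add_zero, Module.length_top] at this
      exact this
    · have := helper_mono hs J ⊥ bot_le
      have e : Submodule.annihilator (⊥ : Ideal A) = ⊤ := Submodule.annihilator_bot
      rw [e, Module.length_bot, zero_add, Module.length_top] at this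
      exact this
  have hfin : ∀ J : Ideal A, Module.length A J ≠ ⊤ := fun J => Module.length_ne_top
  have h1 := hc J
  have h2 := hc J.annihilator
  have h3 : Module.length A J = Module.length A J.annihilator.annihilator := by
    rw [← h2, add_comm] at h1
    exact WithTop.add_left_cancel (hfin _) h1
  have hle : J ≤ J.annihilator.annihilator := by
    intro x hx
    rw [Submodule.mem_annihilator]
    intro z hz
    rw [smul_eq_mul, mul_comm]
    exact Submodule.mem_annihilator.1 hz x hx
  by_contra hne
  have hlt : J < J.annihilator.annihilator := lt_of_le_of_ne hle (Ne.symm hne)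
  have := Submodule.height_strictMono hlt
  rw [← Module.length_submodule, ← Module.length_submodule] at this
  exact this.ne h3

variable {R : Type*} [CommRing R] [IsDomain R]

lemma helper_coe_ne {I : Ideal R} (hI : I ≠ ⊥) :
    (I : FractionalIdeal R⁰ (FractionRing R)) ≠ 0 := by
  simpa using hI

lemma helper_mem_one_div {N : FractionalIdeal R⁰ (FractionRing R)} (hN : N ≠ 0)
    (y : FractionRing R) :
    y ∈ 1 / N ↔ ∀ n ∈ N, ∃ r : R, algebraMap R (FractionRing R) r = y * n := by
  rw [mem_div_iff_of_ne_zero hN]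
  simp only [mem_one_iff]

lemma helper_one_div_ne {N : FractionalIdeal R⁰ (FractionRing R)} (hN : N ≠ 0) : 1 / N ≠ 0 := by
  obtain ⟨a, J, ha, rfl⟩ := exists_eq_spanSingleton_mul N
  intro h
  have : algebraMap R (FractionRing R) a ∈ (1 : FractionalIdeal R⁰ (FractionRing R)) /
      (spanSingleton R⁰ (algebraMap R (FractionRing R) a)⁻¹ * J) := by
    rw [helper_mem_one_div hN]
    intro n hn
    obtain ⟨j, hj, rfl⟩ := mem_singleton_mul.1 hn
    obtain ⟨r, hr, rfl⟩ := (mem_coeIdeal _).1 hj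
    refine ⟨r, ?_⟩
    have : algebraMap R (FractionRing R) a ≠ 0 := by simpa using ha
    field_simp
  rw [h, FractionalIdeal.mem_zero_iff] at this
  exact ha (by simpa using this)

lemma helper_le_dd {N : FractionalIdeal R⁰ (FractionRing R)} (hN : N ≠ 0) :
    N ≤ 1 / (1 / N) := by
  intro y hy
  rw [helper_mem_one_div (helper_one_div_ne hN)]
  intro n hn
  rw [mul_comm]
  exact (helper_mem_one_div hN n).1 hn y hy

lemma helper_div_iff {I : Ideal R} {x : R} (hx : x ≠ 0) (hxI : x ∈ I) :
    I.IsDivisorial ↔ ∀ r, (∀ z, (∀ i ∈ I, x ∣ z * i) → x ∣ r * z) → r ∈ I := by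
  have hI : I ≠ ⊥ := fun h => hx (by simpa [h] using hxI)
  have hI0 := helper_coe_ne hI
  have hx' : algebraMap R (FractionRing R) x ≠ 0 := by simpa using hx
  have inj := IsFractionRing.injective R (FractionRing R)
  have key : ∀ r : R, algebraMap R (FractionRing R) r ∈
      1 / (1 / (I : FractionalIdeal R⁰ (FractionRing R))) ↔
      (∀ z, (∀ i ∈ I, x ∣ z * i) → x ∣ r * z) := by
    intro r
    rw [helper_mem_one_div (helper_one_div_ne hI0)]
    constructor
    · intro h z hz
      obtain ⟨s, hs⟩ := h (algebraMap R _ z / algebraMap R _ x) (by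
        rw [helper_mem_one_div hI0]
        intro n hn
        obtain ⟨i, hi, rfl⟩ := (mem_coeIdeal _).1 hn
        obtain ⟨c, hc⟩ := hz i hi
        refine ⟨c, ?_⟩
        field_simp
        rw [← map_mul, ← map_mul, hc, mul_comm])
      refine ⟨s, inj ?_⟩
      rw [map_mul, map_mul, hs]
      field_simp
    · intro h n hn
      rw [helper_mem_one_div hI0] at hn
      obtain ⟨z, hz⟩ := hn _ ((mem_coeIdeal _).2 ⟨x, hxI, rfl⟩)
      obtain ⟨s, hs⟩ := h z (fun i hi => by
        obtain ⟨t, ht⟩ := hn _ ((mem_coeIdeal _).2 ⟨i, hi, rfl⟩)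
        refine ⟨t, inj ?_⟩
        rw [map_mul, map_mul, hz, ht]
        ring)
      refine ⟨s, mul_left_cancel₀ hx' ?_⟩
      rw [← map_mul, ← hs, map_mul, hz]
      ring
  constructor
  · intro h r hr
    have := (key r).2 hr
    rw [h] at this
    obtain ⟨i, hi, e⟩ := (mem_coeIdeal _).1 this
    rwa [← inj e]
  · intro h
    refine le_antisymm ?_ (helper_le_dd hI0)
    intro y hy
    have h1 : (1 : FractionRing R) ∈ 1 / (I : FractionalIdeal R⁰ (FractionRing R)) := by
      rw [helper_mem_one_div hI0]
      intro n hn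
      obtain ⟨i, hi, rfl⟩ := (mem_coeIdeal _).1 hn
      exact ⟨i, by simp⟩
    obtain ⟨r, hr⟩ := (helper_mem_one_div (helper_one_div_ne hI0) y).1 hy 1 h1
    rw [mul_one] at hr
    subst hr
    exact (mem_coeIdeal _).2 ⟨r, h r ((key r).1 hy), rfl⟩

lemma helper_dd (hd : DivisorialRing R) {N : FractionalIdeal R⁰ (FractionRing R)} (hN : N ≠ 0) :
    1 / (1 / N) = N := by
  refine le_antisymm ?_ (helper_le_dd hN)
  obtain ⟨a, J, ha, rfl⟩ := exists_eq_spanSingleton_mul N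
  have ha' : algebraMap R (FractionRing R) a ≠ 0 := by simpa using ha
  have hJ : J ≠ ⊥ := by
    rintro rfl
    simp at hN
  have hJ0 := helper_coe_ne hJ
  intro y hy
  rw [helper_mem_one_div (helper_one_div_ne hN)] at hy
  have : algebraMap R (FractionRing R) a * y ∈
      1 / (1 / (J : FractionalIdeal R⁰ (FractionRing R))) := by
    rw [helper_mem_one_div (helper_one_div_ne hJ0)]
    intro t ht
    rw [helper_mem_one_div hJ0] at ht
    obtain ⟨s, hs⟩ := hy (algebraMap R (FractionRing R) a * t) (by
      rw [helper_mem_one_div hN]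
      intro n hn
      obtain ⟨j, hj, rfl⟩ := mem_singleton_mul.1 hn
      obtain ⟨r, hr⟩ := ht j hj
      refine ⟨r, ?_⟩
      rw [hr]
      field_simp)
    exact ⟨s, by rw [hs]; ring⟩
  rw [hd J hJ] at this
  refine mem_singleton_mul.2 ⟨_, this, ?_⟩
  field_simp

variable [IsLocalRing R]

lemma helper_max_ne (hR : ¬ IsField R) : IsLocalRing.maximalIdeal R ≠ ⊥ :=
  fun h => hR (IsLocalRing.isField_iff_maximalIdeal_eq.2 h)

lemma helper_one_le (hR : ¬ IsField R) : oneSubmodule R ≤ maxIdealInv R := by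
  intro y hy
  have hy' : y ∈ (1 : FractionalIdeal R⁰ (FractionRing R)) := hy
  change y ∈ 1 / (IsLocalRing.maximalIdeal R : FractionalIdeal R⁰ (FractionRing R))
  rw [helper_mem_one_div (helper_coe_ne (helper_max_ne hR))]
  obtain ⟨r, rfl⟩ := (mem_one_iff _).1 hy'
  intro n hn
  obtain ⟨i, hi, rfl⟩ := (mem_coeIdeal _).1 hn
  exact ⟨r * i, map_mul _ _ _⟩

lemma helper_fwd_cov (hR : ¬ IsField R) (hd : DivisorialRing R) :
    oneSubmodule R ⋖ maxIdealInv R := by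
  have hm := helper_max_ne hR
  have hm0 := helper_coe_ne hm
  constructor
  · refine lt_of_le_of_ne (helper_one_le hR) fun h => ?_
    have h' : (1 : FractionalIdeal R⁰ (FractionRing R)) = 1 / (IsLocalRing.maximalIdeal R) :=
      coe_ext h
    have h2 := hd _ hm
    unfold Ideal.IsDivisorial at h2
    rw [← h', FractionalIdeal.div_one, eq_comm, coeIdeal_eq_one] at h2
    exact (IsLocalRing.maximalIdeal.isMaximal R).ne_top (h2.trans Ideal.one_eq_top)
  · intro N hN1 hN2
    have hfr : IsFractional R⁰ N := isFractional_of_le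
      (J := 1 / (IsLocalRing.maximalIdeal R : FractionalIdeal R⁰ (FractionRing R))) hN2.le
    let F : FractionalIdeal R⁰ (FractionRing R) := ⟨N, hfr⟩
    have hF1 : (1 : FractionalIdeal R⁰ (FractionRing R)) < F := hN1
    have hF2 : F < 1 / (IsLocalRing.maximalIdeal R : FractionalIdeal R⁰ (FractionRing R)) := hN2
    have hF0 : F ≠ 0 := by
      intro h
      rw [h] at hF1
      exact absurd hF1.le (by simp)
    have hle : 1 / F ≤ 1 := by
      intro y hy
      obtain ⟨r, hr⟩ := (helper_mem_one_div hF0 y).1 hy 1 (hF1.le (one_mem_one _))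
      exact (mem_one_iff _).2 ⟨r, by rw [hr, mul_one]⟩
    obtain ⟨L, hL⟩ := le_one_iff_exists_coeIdeal.1 hle
    have hLtop : L ≠ ⊤ := by
      rintro rfl
      have := helper_dd hd hF0
      rw [← hL, coeIdeal_top, FractionalIdeal.div_one] at this
      exact hF1.ne this
    have hmL : (IsLocalRing.maximalIdeal R) ≤ L := by
      rw [← coeIdeal_le_coeIdeal (FractionRing R), hL]
      intro y hy
      rw [helper_mem_one_div hF0]
      intro n hn
      rw [mul_comm]
      exact (helper_mem_one_div hm0 n).1 (hF2.le hn) y hy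
    have hLm : L = IsLocalRing.maximalIdeal R :=
      ((IsLocalRing.maximalIdeal.isMaximal R).eq_of_le hLtop hmL).symm
    have := helper_dd hd hF0
    rw [← hL, hLm] at this
    exact hF2.ne this.symm

lemma helper_fwd_dim [IsNoetherianRing R] (hR : ¬ IsField R) (hd : DivisorialRing R) :
    ringKrullDim R = 1 := by
  rw [ringKrullDim_eq_one_iff_of_isLocalRing_isDomain]
  refine ⟨hR, fun x hx => ?_⟩
  let I : ℕ → Ideal R := fun n => Ideal.span {x} ⊔ IsLocalRing.maximalIdeal R ^ n
  have hxI : ∀ n, x ∈ I n := fun n => Ideal.mem_sup_left (Ideal.mem_span_singleton_self x)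
  have hIanti : Antitone I := fun a b h => sup_le_sup_left (Ideal.pow_le_pow_right h) _
  let g : ℕ → Ideal R := fun n =>
    { carrier := {z | ∀ i ∈ I n, x ∣ z * i}
      add_mem' := fun {a b} ha hb i hi => by
        rw [add_mul]; exact dvd_add (ha i hi) (hb i hi)
      zero_mem' := fun i hi => by simp
      smul_mem' := fun c z hz i hi => by
        rw [smul_eq_mul, mul_assoc]; exact (hz i hi).mul_left c }
  have hg : Monotone g := fun a b h z hz i hi => hz i (hIanti h hi)
  obtain ⟨n, hn⟩ := monotone_stabilizes_iff_noetherian.2 (inferInstance : IsNoetherian R R) ⟨g, hg⟩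
  have hgn : g n = g (n + 1) := hn (n + 1) (Nat.le_succ n)
  have hII : I n ≤ I (n + 1) := by
    intro r hr
    refine (helper_div_iff hx (hxI (n + 1))).1
      (hd _ fun h => hx (by simpa [h] using hxI (n + 1))) r fun z hz => ?_
    have : z ∈ g n := by rw [hgn]; exact hz
    rw [mul_comm]
    exact this r hr
  have hle : IsLocalRing.maximalIdeal R ^ n ≤ Ideal.span {x} := by
    refine Submodule.le_of_le_smul_of_le_jacobson_bot (I := IsLocalRing.maximalIdeal R)
      (IsNoetherian.noetherian _) (IsLocalRing.maximalIdeal_le_jacobson _) ?_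
    refine le_trans (le_trans le_sup_right hII) ?_
    rw [smul_eq_mul, ← pow_succ']
  intro r hr
  exact ⟨n, hle (Ideal.pow_mem_pow hr n)⟩

lemma helper_bwd [IsNoetherianRing R] (hR : ¬ IsField R) (hdim : ringKrullDim R = 1)
    (hc : oneSubmodule R ⋖ maxIdealInv R) : DivisorialRing R := by
  intro I hI
  by_cases htop : I = ⊤
  · subst htop
    unfold Ideal.IsDivisorial
    rw [coeIdeal_top, FractionalIdeal.div_one, FractionalIdeal.div_one]
  obtain ⟨x, hxI, hx⟩ := Submodule.exists_mem_ne_zero_of_ne_bot hI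
  have hx' : algebraMap R (FractionRing R) x ≠ 0 := by simpa using hx
  have inj := IsFractionRing.injective R (FractionRing R)
  have hm0 := helper_coe_ne (helper_max_ne hR)
  rw [helper_div_iff hx hxI]
  let A := R ⧸ Ideal.span {x}
  let q : R →+* A := Ideal.Quotient.mk (Ideal.span {x})
  have hq : Function.Surjective q := Ideal.Quotient.mk_surjective
  have hq0 : ∀ r, q r = 0 ↔ x ∣ r := fun r => by
    rw [← Ideal.mem_span_singleton]; exact Ideal.Quotient.eq_zero_iff_mem
  have hne : Ideal.span {x} ≠ ⊤ := fun h =>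
    htop (top_le_iff.1 (h ▸ (Ideal.span_singleton_le_iff_mem _).2 hxI))
  have : Nontrivial A := Ideal.Quotient.nontrivial_iff.2 hne
  have : IsLocalRing A := IsLocalRing.of_surjective' q hq
  have : IsArtinianRing A := by
    rw [isArtinianRing_iff_krullDimLE_zero, Ring.KrullDimLE, Order.krullDimLE_iff,
      ← ENat.WithBot.add_le_add_one_right_iff, Nat.cast_zero, zero_add]
    exact (ringKrullDim_quotient_succ_le_of_nonZeroDivisor
      (mem_nonZeroDivisors_of_ne_zero hx)).trans hdim.le
  have hmem : ∀ z : R, q z ∈ (IsLocalRing.maximalIdeal A).annihilator →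
      algebraMap R (FractionRing R) z / algebraMap R _ x ∈ maxIdealInv R := by
    intro z hz
    change _ ∈ 1 / (IsLocalRing.maximalIdeal R : FractionalIdeal R⁰ (FractionRing R))
    rw [helper_mem_one_div hm0]
    intro n hn
    obtain ⟨i, hi, rfl⟩ := (mem_coeIdeal _).1 hn
    have hqi : q i ∈ IsLocalRing.maximalIdeal A := by
      have : IsLocalHom q := IsLocalHom.of_surjective q hq
      exact (map_mem_nonunits_iff q i).2 hi
    have h0 := Submodule.mem_annihilator.1 hz _ hqi
    rw [smul_eq_mul, ← map_mul, hq0] at h0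
    obtain ⟨c, hc⟩ := h0
    refine ⟨c, ?_⟩
    field_simp
    rw [← map_mul, ← map_mul, hc, mul_comm]
  have hsoc : ∀ z w : A, z ∈ (IsLocalRing.maximalIdeal A).annihilator →
      w ∈ (IsLocalRing.maximalIdeal A).annihilator → w ≠ 0 → ∃ r : A, r * w = z := by
    intro z w hz hw hw0
    obtain ⟨z, rfl⟩ := hq z
    obtain ⟨w, rfl⟩ := hq w
    have hz' := hmem z hz
    have hw' := hmem w hw
    set W := algebraMap R (FractionRing R) w / algebraMap R _ x with hW
    have hWn : W ∉ oneSubmodule R := by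
      intro h
      obtain ⟨s, hs⟩ := (mem_one_iff R⁰).1 h
      apply hw0
      rw [hq0]
      refine ⟨s, inj ?_⟩
      rw [map_mul, hs, hW]
      field_simp
    have hlt : oneSubmodule R < oneSubmodule R ⊔ Submodule.span R {W} := by
      refine lt_of_le_of_ne le_sup_left fun he => hWn ?_
      rw [he]
      exact Submodule.mem_sup_right (Submodule.mem_span_singleton_self W)
    have hle : oneSubmodule R ⊔ Submodule.span R {W} ≤ maxIdealInv R :=
      sup_le hc.le ((Submodule.span_singleton_le_iff_mem _ _).2 hw')
    have heq : oneSubmodule R ⊔ Submodule.span R {W} = maxIdealInv R := by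
      rcases hle.lt_or_eq with h | h
      · exact (hc.2 hlt h).elim
      · exact h
    rw [← heq] at hz'
    obtain ⟨s, hs, t, ht, e⟩ := Submodule.mem_sup.1 hz'
    obtain ⟨s, rfl⟩ := (mem_one_iff R⁰).1 hs
    obtain ⟨r, rfl⟩ := Submodule.mem_span_singleton.1 ht
    refine ⟨q r, ?_⟩
    rw [← map_mul, eq_comm, ← sub_eq_zero, ← map_sub, hq0]
    refine ⟨s, inj ?_⟩
    rw [Algebra.smul_def, hW] at e
    field_simp at e
    rw [map_sub, map_mul, map_mul]
    linear_combination -e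
  have hs : Module.length A (IsLocalRing.maximalIdeal A).annihilator ≤ 1 := by
    rcases subsingleton_or_nontrivial (IsLocalRing.maximalIdeal A).annihilator with h | h
    · rw [Module.length_eq_zero]; exact zero_le_one
    · have : IsSimpleModule A (IsLocalRing.maximalIdeal A).annihilator := by
        rw [isSimpleModule_iff_toSpanSingleton_surjective]
        refine ⟨h, fun w hw z => ?_⟩
        obtain ⟨r, hr⟩ := hsoc z w z.2 w.2 (fun h => hw (Subtype.ext h))
        exact ⟨r, Subtype.ext hr⟩
      rw [Module.length_eq_one]
  intro r hr
  have hann := helper_annann hs (I.map q)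
  have hrm : q r ∈ I.map q := by
    rw [← hann, Submodule.mem_annihilator]
    intro z hz
    obtain ⟨z, rfl⟩ := hq z
    rw [smul_eq_mul, ← map_mul, hq0]
    apply hr
    intro i hi
    rw [← hq0, map_mul]
    exact Submodule.mem_annihilator.1 hz _ (Ideal.mem_map_of_mem q hi)
  obtain ⟨i, hi, e⟩ := (Ideal.mem_map_iff_of_surjective q hq).1 hrm
  have h0 : q (r - i) = 0 := by rw [map_sub, e, sub_self]
  obtain ⟨c, hc⟩ := (hq0 _).1 h0
  have : r = i + c * x := by linear_combination hc
  rw [this]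
  exact I.add_mem hi (I.mul_mem_left c hxI)

end Helpers

theorem local_noetherian_divisorial_iff (R : Type*) [CommRing R] [IsDomain R] [IsLocalRing R]
    [IsNoetherianRing R] (hR : ¬ IsField R) :
    DivisorialRing R ↔
      (ringKrullDim R = 1 ∧
        IsSimpleModule R
          (↥(maxIdealInv R) ⧸ Submodule.comap (maxIdealInv R).subtype (oneSubmodule R))) := by
  rw [← covBy_iff_quot_is_simple (helper_one_le hR)]
  exact ⟨fun hd => ⟨helper_fwd_dim hR hd, helper_fwd_cov hR hd⟩, fun h => helper_bwd hR h.1 h.2⟩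
end
end
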